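/- arXiv:1808.10064 — 14 statements merged into one kernel-verified Lean document; each statement's English description precedes it below -/
import Mathlib

section
/- The linear maps R and S preserve the configuration space of the delta manipulator: for every point x ∈ ℝ^15 with F(x) = 0, one also has F(R x) = 0 and F(S x) = 0. -/
/-- The constraint map of the delta manipulator.
Coordinates: `x 0..x 8` are `x₁,y₁,z₁,x₂,y₂,z₂,x₃,y₃,z₃`;
`x 9..x 14` are `ca₁,sa₁,ca₂,sa₂,ca₃,sa₃`. -/
noncomputable def deltaF (a b d : ℝ) (x : Fin 15 → ℝ) : Fin 12 → ℝ :=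
  ![ x 0 ^ 2 + x 1 ^ 2 + x 2 ^ 2 - b ^ 2,
     x 3 ^ 2 + x 4 ^ 2 + x 5 ^ 2 - b ^ 2,
     x 6 ^ 2 + x 7 ^ 2 + x 8 ^ 2 - b ^ 2,
     x 9 ^ 2 + x 10 ^ 2 - a ^ 2,
     x 11 ^ 2 + x 12 ^ 2 - a ^ 2,
     x 13 ^ 2 + x 14 ^ 2 - a ^ 2,
     -- l₁,l₂,l₃ : components of v₁ - A v₂
     (d + x 9 + x 0) - (-(1/2) * (d + x 11 + x 3) - (Real.sqrt 3 / 2) * x 4),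
     x 1 - ((Real.sqrt 3 / 2) * (d + x 11 + x 3) - (1/2) * x 4),
     (x 10 + x 2) - (x 12 + x 5),
     -- l₄,l₅,l₆ : components of v₁ - A⁻¹ v₃
     (d + x 9 + x 0) - (-(1/2) * (d + x 13 + x 6) + (Real.sqrt 3 / 2) * x 7),
     x 1 - (-(Real.sqrt 3 / 2) * (d + x 13 + x 6) - (1/2) * x 7),
     (x 10 + x 2) - (x 14 + x 8) ]

/-- The linear map `R` : cyclic permutation `(P₁,P₂,P₃,w₁,w₂,w₃) ↦ (P₂,P₃,P₁,w₂,w₃,w₁)`. -/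
def deltaR (x : Fin 15 → ℝ) : Fin 15 → ℝ :=
  ![x 3, x 4, x 5, x 6, x 7, x 8, x 0, x 1, x 2, x 11, x 12, x 13, x 14, x 9, x 10]

/-- The linear map `S` : the reflection `(P₁,P₂,P₃,w₁,w₂,w₃) ↦ (σP₁,σP₂,σP₃,τw₁,τw₂,τw₃)`
with `σ(x,y,z) = (x,y,-z)` and `τ(u,v) = (u,-v)`. -/
def deltaS (x : Fin 15 → ℝ) : Fin 15 → ℝ :=
  ![x 0, x 1, -x 2, x 3, x 4, -x 5, x 6, x 7, -x 8, x 9, -x 10, x 11, -x 12, x 13, -x 14]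

/-- The linear maps `R` and `S` preserve the configuration space of the delta manipulator. -/
theorem delta_symmetry_preserves_configuration_space (a b d : ℝ) (x : Fin 15 → ℝ)
    (hx : deltaF a b d x = 0) :
    deltaF a b d (deltaR x) = 0 ∧ deltaF a b d (deltaS x) = 0 := by
  have hs : Real.sqrt 3 * Real.sqrt 3 = 3 := Real.mul_self_sqrt (by norm_num)
  have s₁ : x 0 ^ 2 + x 1 ^ 2 + x 2 ^ 2 - b ^ 2 = 0 := congrFun hx 0
  have s₂ : x 3 ^ 2 + x 4 ^ 2 + x 5 ^ 2 - b ^ 2 = 0 := congrFun hx 1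
  have s₃ : x 6 ^ 2 + x 7 ^ 2 + x 8 ^ 2 - b ^ 2 = 0 := congrFun hx 2
  have c₁ : x 9 ^ 2 + x 10 ^ 2 - a ^ 2 = 0 := congrFun hx 3
  have c₂ : x 11 ^ 2 + x 12 ^ 2 - a ^ 2 = 0 := congrFun hx 4
  have c₃ : x 13 ^ 2 + x 14 ^ 2 - a ^ 2 = 0 := congrFun hx 5
  have l₁ : (d + x 9 + x 0) - (-(1/2) * (d + x 11 + x 3) - (Real.sqrt 3 / 2) * x 4) = 0 :=
    congrFun hx 6
  have l₂ : x 1 - ((Real.sqrt 3 / 2) * (d + x 11 + x 3) - (1/2) * x 4) = 0 := congrFun hx 7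
  have l₃ : (x 10 + x 2) - (x 12 + x 5) = 0 := congrFun hx 8
  have l₄ : (d + x 9 + x 0) - (-(1/2) * (d + x 13 + x 6) + (Real.sqrt 3 / 2) * x 7) = 0 :=
    congrFun hx 9
  have l₅ : x 1 - (-(Real.sqrt 3 / 2) * (d + x 13 + x 6) - (1/2) * x 7) = 0 := congrFun hx 10
  have l₆ : (x 10 + x 2) - (x 14 + x 8) = 0 := congrFun hx 11
  constructor
  · have r₁ : (d + x 11 + x 3) - (-(1/2) * (d + x 13 + x 6) - (Real.sqrt 3 / 2) * x 7) = 0 := by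
      linear_combination (1/2) * (l₁ - l₄) - (Real.sqrt 3 / 2) * (l₂ - l₅)
        - (1/4) * ((d + x 11 + x 3) + (d + x 13 + x 6)) * hs
    have r₂ : x 4 - ((Real.sqrt 3 / 2) * (d + x 13 + x 6) - (1/2) * x 7) = 0 := by
      linear_combination (Real.sqrt 3 / 2) * (l₁ - l₄) + (1/2) * (l₂ - l₅)
        - (1/4) * (x 4 + x 7) * hs
    have r₃ : (x 12 + x 5) - (x 14 + x 8) = 0 := by linear_combination l₆ - l₃
    have r₄ : (d + x 11 + x 3) - (-(1/2) * (d + x 9 + x 0) + (Real.sqrt 3 / 2) * x 1) = 0 := by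
      linear_combination (1/2) * l₁ - (Real.sqrt 3 / 2) * l₂ - (1/4) * (d + x 11 + x 3) * hs
    have r₅ : x 4 - (-(Real.sqrt 3 / 2) * (d + x 9 + x 0) - (1/2) * x 1) = 0 := by
      linear_combination (Real.sqrt 3 / 2) * l₁ + (1/2) * l₂ - (1/4) * x 4 * hs
    have r₆ : (x 12 + x 5) - (x 10 + x 2) = 0 := by linear_combination -l₃
    funext i
    fin_cases i
    exacts [s₂, s₃, s₁, c₂, c₃, c₁, r₁, r₂, r₃, r₄, r₅, r₆]
  · have t₁ : x 0 ^ 2 + x 1 ^ 2 + (-x 2) ^ 2 - b ^ 2 = 0 := by rwa [neg_sq]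
    have t₂ : x 3 ^ 2 + x 4 ^ 2 + (-x 5) ^ 2 - b ^ 2 = 0 := by rwa [neg_sq]
    have t₃ : x 6 ^ 2 + x 7 ^ 2 + (-x 8) ^ 2 - b ^ 2 = 0 := by rwa [neg_sq]
    have e₁ : x 9 ^ 2 + (-x 10) ^ 2 - a ^ 2 = 0 := by rwa [neg_sq]
    have e₂ : x 11 ^ 2 + (-x 12) ^ 2 - a ^ 2 = 0 := by rwa [neg_sq]
    have e₃ : x 13 ^ 2 + (-x 14) ^ 2 - a ^ 2 = 0 := by rwa [neg_sq]
    have m₃ : (-x 10 + -x 2) - (-x 12 + -x 5) = 0 := by linear_combination -l₃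
    have m₆ : (-x 10 + -x 2) - (-x 14 + -x 8) = 0 := by linear_combination -l₆
    funext i
    fin_cases i
    exacts [t₁, t₂, t₃, e₁, e₂, e₃, l₁, l₂, m₃, l₄, l₅, m₆]
end

section
/- The linear maps R and S preserve the singular locus of the constraint map: if x ∈ ℝ^15 satisfies F(x) = 0 and the total derivative DF(x) : ℝ^15 → ℝ^12 is not surjective, then F(Rx) = 0 and DF(Rx) is not surjective, and likewise F(Sx) = 0 and DF(Sx) is not surjective. -/
/-- If a differentiable map `f` intertwines a surjective `T` and an injective `L`, then `T` sends
points where the derivative of `f` is not surjective to such points. -/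
theorem not_surjective_fderiv_of_semiconj {E G : Type*} [NormedAddCommGroup E] [NormedSpace ℝ E]
    [NormedAddCommGroup G] [NormedSpace ℝ G] {f : E → G} (hf : Differentiable ℝ f)
    {T : E →L[ℝ] E} {L : G →L[ℝ] G} (hT : Function.Surjective T) (hL : Function.Injective L)
    (h : Function.Semiconj f T L) {x : E} (hx : ¬ Function.Surjective (fderiv ℝ f x)) :
    ¬ Function.Surjective (fderiv ℝ f (T x)) := by
  intro hs
  have h₁ : HasFDerivAt (f ∘ T) ((fderiv ℝ f (T x)).comp T) x :=
    (hf (T x)).hasFDerivAt.comp x T.hasFDerivAt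
  have h₂ : HasFDerivAt (L ∘ f) (L.comp (fderiv ℝ f x)) x :=
    L.hasFDerivAt.comp x (hf x).hasFDerivAt
  rw [h.comp_eq] at h₁
  have h₃ : Function.Surjective (L ∘ fderiv ℝ f x) := by
    rw [← ContinuousLinearMap.coe_comp, ← h₁.unique h₂, ContinuousLinearMap.coe_comp]
    exact hs.comp hT
  exact hx fun u => (h₃ (L u)).imp fun _ hv => hL hv

theorem singular_of_semiconj {m n : ℕ} {f : (Fin n → ℝ) → Fin m → ℝ} (hf : Differentiable ℝ f)
    {T : (Fin n → ℝ) → Fin n → ℝ} {L : (Fin m → ℝ) → Fin m → ℝ}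
    (hTl : IsLinearMap ℝ T) (hLl : IsLinearMap ℝ L)
    (hT : Function.Surjective T) (hL : Function.Injective L)
    (h : Function.Semiconj f T L) {x : Fin n → ℝ} (h0 : f x = 0)
    (hx : ¬ Function.Surjective (fderiv ℝ f x)) :
    f (T x) = 0 ∧ ¬ Function.Surjective (fderiv ℝ f (T x)) :=
  ⟨by rw [h.eq, h0, hLl.map_zero],
    not_surjective_fderiv_of_semiconj (T := (hTl.mk' T).toContinuousLinearMap)
      (L := (hLl.mk' L).toContinuousLinearMap) hf hT hL h hx⟩

theorem differentiable_deltaF (a b d : ℝ) : Differentiable ℝ (deltaF a b d) := by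
  rw [differentiable_pi]
  intro i
  fin_cases i <;> simp only [deltaF] <;> simp <;> fun_prop

theorem isLinearMap_deltaR : IsLinearMap ℝ deltaR where
  map_add x y := by ext i; fin_cases i <;> rfl
  map_smul c x := by ext i; fin_cases i <;> rfl

theorem isLinearMap_deltaS : IsLinearMap ℝ deltaS where
  map_add x y := by ext i; fin_cases i <;> simp [deltaS] <;> ring
  map_smul c x := by ext i; fin_cases i <;> simp [deltaS]

theorem surjective_deltaR : Function.Surjective deltaR := fun x =>
  ⟨deltaR (deltaR x), by ext i; fin_cases i <;> rfl⟩

theorem surjective_deltaS : Function.Surjective deltaS := fun x =>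
  ⟨deltaS x, by ext i; fin_cases i <;> simp [deltaS]⟩

/-- The linear action on the constraint values induced by `deltaR`. With `l = v₁ - A v₂` and
`m = v₁ - A⁻¹ v₃`, it sends `(l, m)` to `(A⁻¹ (m - l), -A⁻¹ l)`. -/
noncomputable def deltaRValue (u : Fin 12 → ℝ) : Fin 12 → ℝ :=
  ![u 1, u 2, u 0, u 4, u 5, u 3,
    -(1 / 2) * (u 9 - u 6) + √3 / 2 * (u 10 - u 7),
    -(√3 / 2) * (u 9 - u 6) - 1 / 2 * (u 10 - u 7),
    u 11 - u 8,
    1 / 2 * u 6 - √3 / 2 * u 7,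
    √3 / 2 * u 6 + 1 / 2 * u 7,
    -u 8]

/-- The linear action on the constraint values induced by `deltaS`. -/
def deltaSValue (u : Fin 12 → ℝ) : Fin 12 → ℝ :=
  ![u 0, u 1, u 2, u 3, u 4, u 5, u 6, u 7, -u 8, u 9, u 10, -u 11]

theorem isLinearMap_deltaRValue : IsLinearMap ℝ deltaRValue where
  map_add x y := by ext i; fin_cases i <;> simp [deltaRValue] <;> ring
  map_smul c x := by ext i; fin_cases i <;> simp [deltaRValue] <;> ring

theorem isLinearMap_deltaSValue : IsLinearMap ℝ deltaSValue where
  map_add x y := by ext i; fin_cases i <;> simp [deltaSValue] <;> ring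
  map_smul c x := by ext i; fin_cases i <;> simp [deltaSValue]

theorem injective_deltaRValue : Function.Injective deltaRValue := by
  have h3 : √3 * √3 = (3 : ℝ) := Real.mul_self_sqrt (by norm_num)
  refine Function.LeftInverse.injective (g := deltaRValue ∘ deltaRValue) fun u => ?_
  ext i
  fin_cases i <;> simp [deltaRValue] <;> grind

theorem injective_deltaSValue : Function.Injective deltaSValue :=
  Function.LeftInverse.injective (g := deltaSValue) fun u => by
    ext i; fin_cases i <;> simp [deltaSValue]

theorem semiconj_deltaR (a b d : ℝ) :
    Function.Semiconj (deltaF a b d) deltaR deltaRValue := by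
  have h3 : √3 * √3 = (3 : ℝ) := Real.mul_self_sqrt (by norm_num)
  intro x
  ext i
  fin_cases i <;> simp [deltaF, deltaR, deltaRValue] <;> grind

theorem semiconj_deltaS (a b d : ℝ) :
    Function.Semiconj (deltaF a b d) deltaS deltaSValue := by
  intro x
  ext i
  fin_cases i <;> simp [deltaF, deltaS, deltaSValue] <;> ring


/-- The linear maps `R` and `S` preserve the singular locus of the constraint map `F`. -/
theorem delta_symmetry_preserves_singular_locus (a b d : ℝ) (x : Fin 15 → ℝ)
    (hx : deltaF a b d x = 0)
    (hsing : ¬ Function.Surjective (fderiv ℝ (deltaF a b d) x)) :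
    (deltaF a b d (deltaR x) = 0 ∧
      ¬ Function.Surjective (fderiv ℝ (deltaF a b d) (deltaR x))) ∧
    (deltaF a b d (deltaS x) = 0 ∧
      ¬ Function.Surjective (fderiv ℝ (deltaF a b d) (deltaS x))) := by
  exact ⟨singular_of_semiconj (differentiable_deltaF a b d) isLinearMap_deltaR
      isLinearMap_deltaRValue surjective_deltaR injective_deltaRValue
      (semiconj_deltaR a b d) hx hsing,
    singular_of_semiconj (differentiable_deltaF a b d) isLinearMap_deltaS
      isLinearMap_deltaSValue surjective_deltaS injective_deltaSValue
      (semiconj_deltaS a b d) hx hsing⟩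
end

section
/- Suppose a > d > 0 and b > 0. Then F(q₁) = 0, i.e. q₁ lies in the configuration space X_{a,b,d}, and the total derivative DF(q₁) : ℝ^15 → ℝ^12 is not surjective (equivalently, the 12×15 Jacobian matrix of F at q₁ has rank strictly less than 12). -/
/-- The singular point `q₁` of the delta manipulator. -/
noncomputable def deltaQ1 (a b d : ℝ) : Fin 15 → ℝ :=
  let q := Real.sqrt (a ^ 2 + 3 * d ^ 2)
  let s := Real.sqrt (a ^ 2 - d ^ 2)
  ![ -(d * b / q), -(Real.sqrt 3 * d * b / q), s * b / q,
     -(d * b / q), Real.sqrt 3 * d * b / q, s * b / q,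
     2 * d * b / q, 0, s * b / q,
     -d, s, -d, s, -d, s ]

/-- A linear combination of the constraints which, along every line through `deltaQ1 a b d`, is
purely quadratic in the line parameter. -/
theorem deltaF_combination_along_line (a b d t : ℝ) (v : Fin 15 → ℝ) :
    let k := b / Real.sqrt (a ^ 2 + 3 * d ^ 2)
    let y := deltaF a b d (deltaQ1 a b d + t • v)
    (-y 0) + y 1 - k * y 3 + k * y 4 - 2 * (d * k) * y 6 - 2 * (Real.sqrt 3 * d * k) * y 7
        + 2 * (Real.sqrt (a ^ 2 - d ^ 2) * k) * y 8 =
      t ^ 2 * (-(v 0 ^ 2 + v 1 ^ 2 + v 2 ^ 2) + (v 3 ^ 2 + v 4 ^ 2 + v 5 ^ 2)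
        - k * (v 9 ^ 2 + v 10 ^ 2) + k * (v 11 ^ 2 + v 12 ^ 2)) := by
  have h3 : Real.sqrt 3 ^ 2 = 3 := Real.sq_sqrt (by norm_num)
  simp [deltaF, deltaQ1]
  generalize Real.sqrt (a ^ 2 - d ^ 2) = s
  generalize Real.sqrt (a ^ 2 + 3 * d ^ 2) = q
  generalize Real.sqrt 3 = r at *
  simp only [div_eq_mul_inv]
  ring_nf
  simp only [h3]
  ring

theorem deltaF_deltaQ1 {a b d : ℝ} (had : a > d) (hd : d > 0) :
    deltaF a b d (deltaQ1 a b d) = 0 := by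
  have h3 : Real.sqrt 3 ^ 2 = 3 := Real.sq_sqrt (by norm_num)
  have hs : Real.sqrt (a ^ 2 - d ^ 2) ^ 2 = a ^ 2 - d ^ 2 := Real.sq_sqrt (by nlinarith)
  have hq : Real.sqrt (a ^ 2 + 3 * d ^ 2) ^ 2 = a ^ 2 + 3 * d ^ 2 := Real.sq_sqrt (by positivity)
  have hq0 : Real.sqrt (a ^ 2 + 3 * d ^ 2) ≠ 0 := by positivity
  ext i
  fin_cases i <;> simp [deltaF, deltaQ1] <;>
    generalize Real.sqrt (a ^ 2 - d ^ 2) = s at * <;>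
    generalize Real.sqrt (a ^ 2 + 3 * d ^ 2) = q at * <;>
    generalize Real.sqrt 3 = r at * <;>
    field_simp <;> grind

/-- `q₁` lies in the configuration space `X_{a,b,d}` and the derivative `DF(q₁)` is not
surjective. -/
theorem deltaQ1_mem_and_singular (a b d : ℝ) (had : a > d) (hd : d > 0) (hb : b > 0) :
    deltaF a b d (deltaQ1 a b d) = 0 ∧
      ¬ Function.Surjective (fderiv ℝ (deltaF a b d) (deltaQ1 a b d)) := by
  refine ⟨deltaF_deltaQ1 had hd, fun hsurj => ?_⟩
  obtain ⟨v, hv⟩ := hsurj (Pi.single 0 1)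
  have hline : HasDerivAt (fun t : ℝ => deltaF a b d (deltaQ1 a b d + t • v))
      (Pi.single 0 1) 0 := by
    rw [← hv]
    exact (differentiable_deltaF a b d _).hasFDerivAt.hasLineDerivAt v
  have hy := hasDerivAt_pi.1 hline
  set k := b / Real.sqrt (a ^ 2 + 3 * d ^ 2)
  have hcomb := ((((((hy 0).neg.add (hy 1)).sub ((hy 3).const_mul k)).add
    ((hy 4).const_mul k)).sub ((hy 6).const_mul (2 * (d * k)))).sub
    ((hy 7).const_mul (2 * (Real.sqrt 3 * d * k)))).add
    ((hy 8).const_mul (2 * (Real.sqrt (a ^ 2 - d ^ 2) * k)))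
  have hquad := ((hasDerivAt_id (0 : ℝ)).pow 2).mul_const
    (-(v 0 ^ 2 + v 1 ^ 2 + v 2 ^ 2) + (v 3 ^ 2 + v 4 ^ 2 + v 5 ^ 2)
      - k * (v 9 ^ 2 + v 10 ^ 2) + k * (v 11 ^ 2 + v 12 ^ 2))
  have huniq := hcomb.unique (hquad.congr_of_eventuallyEq
    (Filter.Eventually.of_forall fun t => deltaF_combination_along_line a b d t v))
  simp at huniq
end

section
/- Suppose a > d > 0 and b > 0. Then F(q₄) = 0, i.e. q₄ lies in the configuration space X_{a,b,d}, and the total derivative DF(q₄) : ℝ^15 → ℝ^12 is not surjective (equivalently, the 12×15 Jacobian matrix of F at q₄ has rank strictly less than 12). In particular the denominators appearing in the coordinates of q₄ are nonzero, so q₄ is a well-defined real point. -/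
/-- The singular point `q₄` of the delta manipulator. -/
noncomputable def deltaQ4 (a b d : ℝ) : Fin 15 → ℝ :=
  let q := Real.sqrt (a ^ 2 + 3 * d ^ 2)
  let s := Real.sqrt (a ^ 2 - d ^ 2)
  let Dp := 2 * b * q * (a ^ 2 - 3 * d ^ 2) + q ^ 2 * (a ^ 2 + b ^ 2)
  ![ -(d * b / q), -(Real.sqrt 3 * d * b / q), s * b / q,
     -(d * b / q), Real.sqrt 3 * d * b / q, s * b / q,
     -(2 * b * d * (b * q + 2 * a ^ 2 - b ^ 2 - 3 * d ^ 2)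
       / (2 * b * (a ^ 2 - 3 * d ^ 2) + q * (a ^ 2 + b ^ 2))),
     0,
     b * s * (2 * b * q + a ^ 2 + b ^ 2 - 6 * d ^ 2)
       / (2 * b * (a ^ 2 - 3 * d ^ 2) + q * (a ^ 2 + b ^ 2)),
     -d, s, -d, s,
     6 * b * d * (a ^ 2 - d ^ 2) * (b + q) / Dp - d,
     6 * b * d ^ 2 * s * (q - 2 * b) / Dp + s ]

theorem delta_denominator_pos {a b d : ℝ} (had : a > d) (hd : d > 0) (hb : b > 0) :
    0 < 2 * b * (a ^ 2 - 3 * d ^ 2) + Real.sqrt (a ^ 2 + 3 * d ^ 2) * (a ^ 2 + b ^ 2) := by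
  have hq2 : Real.sqrt (a ^ 2 + 3 * d ^ 2) ^ 2 = a ^ 2 + 3 * d ^ 2 :=
    Real.sq_sqrt (by positivity)
  have hq : 0 < Real.sqrt (a ^ 2 + 3 * d ^ 2) := Real.sqrt_pos.2 (by positivity)
  generalize Real.sqrt (a ^ 2 + 3 * d ^ 2) = q at hq hq2 ⊢
  have ha : 0 < a ^ 2 - d ^ 2 := by nlinarith
  have key : 2 * b * (a ^ 2 - 3 * d ^ 2) + q * (a ^ 2 + b ^ 2)
      = q * (b - q / 2) ^ 2 + (3 * b + 3 / 4 * q) * (a ^ 2 - d ^ 2) := by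
    linear_combination (b - q / 4) * hq2
  rw [key]
  positivity

theorem deltaF_deltaQ4 {a b d : ℝ} (had : a > d) (hd : d > 0) (hb : b > 0) :
    deltaF a b d (deltaQ4 a b d) = 0 := by
  have hN := (delta_denominator_pos had hd hb).ne'
  have hq : Real.sqrt (a ^ 2 + 3 * d ^ 2) ≠ 0 := (Real.sqrt_pos.2 (by positivity)).ne'
  have hq2 : Real.sqrt (a ^ 2 + 3 * d ^ 2) ^ 2 = a ^ 2 + 3 * d ^ 2 :=
    Real.sq_sqrt (by positivity)
  have hs2 : Real.sqrt (a ^ 2 - d ^ 2) ^ 2 = a ^ 2 - d ^ 2 := Real.sq_sqrt (by nlinarith)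
  have hr2 : Real.sqrt 3 ^ 2 = 3 := Real.sq_sqrt (by norm_num)
  have hDp : 2 * b * Real.sqrt (a ^ 2 + 3 * d ^ 2) * (a ^ 2 - 3 * d ^ 2)
        + Real.sqrt (a ^ 2 + 3 * d ^ 2) ^ 2 * (a ^ 2 + b ^ 2)
      = Real.sqrt (a ^ 2 + 3 * d ^ 2) * (2 * b * (a ^ 2 - 3 * d ^ 2)
        + Real.sqrt (a ^ 2 + 3 * d ^ 2) * (a ^ 2 + b ^ 2)) := by ring
  unfold deltaQ4 deltaF
  dsimp only
  rw [hDp]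
  generalize Real.sqrt (a ^ 2 + 3 * d ^ 2) = q at *
  generalize Real.sqrt (a ^ 2 - d ^ 2) = s at *
  generalize Real.sqrt 3 = r at *
  generalize hNe : 2 * b * (a ^ 2 - 3 * d ^ 2) + q * (a ^ 2 + b ^ 2) = N at *
  have ha2 : a ^ 2 = q ^ 2 - 3 * d ^ 2 := by linarith
  rw [ha2] at hNe
  ext i
  fin_cases i <;> simp
  all_goals field_simp
  all_goals try simp only [ha2, hs2, hr2, ← hNe]
  all_goals ring

theorem hasDerivAt_const_add_sq_mul_zero (c k : ℝ) :
    HasDerivAt (fun t : ℝ => c + t ^ 2 * k) 0 0 := by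
  simpa using ((hasDerivAt_pow 2 (0 : ℝ)).mul_const k).const_add c

theorem deltaF_derivative_not_surjective {a b d : ℝ} (hd : d > 0) (hb : b > 0) :
    ¬ Function.Surjective (fderiv ℝ (deltaF a b d) (deltaQ4 a b d)) := by
  intro hsurj
  set q := Real.sqrt (a ^ 2 + 3 * d ^ 2) with hqdef
  have hq : q ≠ 0 := (Real.sqrt_pos.2 (by positivity)).ne'
  set s := Real.sqrt (a ^ 2 - d ^ 2) with hsdef
  let w : Fin 12 → ℝ :=
    ![-(q / (2 * b)), q / (2 * b), 0, -(1 / 2), 1 / 2, 0, -d, -(Real.sqrt 3 * d), s, 0, 0, 0]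
  obtain ⟨v, hv⟩ := hsurj (Pi.single 3 1)
  have hline : HasDerivAt (fun t : ℝ => deltaF a b d (deltaQ4 a b d + t • v))
      (Pi.single 3 1) 0 := by
    have h := (differentiable_deltaF a b d (deltaQ4 a b d)).hasFDerivAt.hasLineDerivAt v
    rw [hv] at h
    exact h
  have hsum : HasDerivAt
      (fun t : ℝ => ∑ i, w i * deltaF a b d (deltaQ4 a b d + t • v) i)
      (∑ i, w i * (Pi.single 3 1 : Fin 12 → ℝ) i) 0 :=
    HasDerivAt.fun_sum fun i _ => ((hasDerivAt_pi.1 hline) i).const_mul (w i)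
  have hquad : ∀ t : ℝ, ∑ i, w i * deltaF a b d (deltaQ4 a b d + t • v) i
      = ∑ i, w i * deltaF a b d (deltaQ4 a b d) i
        + t ^ 2 * (q / (2 * b) * (v 3 ^ 2 + v 4 ^ 2 + v 5 ^ 2 - v 0 ^ 2 - v 1 ^ 2 - v 2 ^ 2)
          + 1 / 2 * (v 11 ^ 2 + v 12 ^ 2 - v 9 ^ 2 - v 10 ^ 2)) := by
    intro t
    have hr2 : Real.sqrt 3 ^ 2 = 3 := Real.sq_sqrt (by norm_num)
    simp [Fin.sum_univ_succ, w, deltaF, deltaQ4, ← hqdef, ← hsdef]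
    field_simp
    linear_combination b * d * q * t * (v 3 + v 11) * hr2
  have hzero : HasDerivAt
      (fun t : ℝ => ∑ i, w i * deltaF a b d (deltaQ4 a b d + t • v) i) 0 0 := by
    simp_rw [hquad]
    exact hasDerivAt_const_add_sq_mul_zero _ _
  have h := hsum.unique hzero
  simp [Pi.single_apply, w] at h

/-- `q₄` lies in the configuration space `X_{a,b,d}` and the derivative `DF(q₄)` is not
surjective.  In particular the denominators occurring in the coordinates of `q₄` are
nonzero, so `q₄` is a well-defined real point. -/
theorem deltaQ4_mem_and_singular (a b d : ℝ) (had : a > d) (hd : d > 0) (hb : b > 0) :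
    (2 * b * (a ^ 2 - 3 * d ^ 2) + Real.sqrt (a ^ 2 + 3 * d ^ 2) * (a ^ 2 + b ^ 2) ≠ 0) ∧
    (2 * b * Real.sqrt (a ^ 2 + 3 * d ^ 2) * (a ^ 2 - 3 * d ^ 2)
        + Real.sqrt (a ^ 2 + 3 * d ^ 2) ^ 2 * (a ^ 2 + b ^ 2) ≠ 0) ∧
    deltaF a b d (deltaQ4 a b d) = 0 ∧
      ¬ Function.Surjective (fderiv ℝ (deltaF a b d) (deltaQ4 a b d)) := by
  have hN := (delta_denominator_pos had hd hb).ne'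
  have hq : Real.sqrt (a ^ 2 + 3 * d ^ 2) ≠ 0 := (Real.sqrt_pos.2 (by positivity)).ne'
  refine ⟨hN, ?_, deltaF_deltaQ4 had hd hb, deltaF_derivative_not_surjective hd hb⟩
  convert mul_ne_zero hq hN using 1
  ring
end

section
/- Suppose a > d > 0 and b > 0. The dihedral group D₃ acts freely on the orbits of the four singular points: for every g ∈ {R, R², S, RS, R²S} (the five non-identity elements of the group of linear maps generated by R and S) and for each i ∈ {1,2,3,4}, one has g·qᵢ ≠ qᵢ. -/
/-- The singular point `q₂` of the delta manipulator. -/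
noncomputable def deltaQ2 (a b d : ℝ) : Fin 15 → ℝ :=
  let q := Real.sqrt (a ^ 2 + 3 * d ^ 2)
  let s := Real.sqrt (a ^ 2 - d ^ 2)
  ![ d * b / q, Real.sqrt 3 * d * b / q, s * b / q,
     d * b / q, -(Real.sqrt 3 * d * b / q), s * b / q,
     -(2 * d * b / q), 0, s * b / q,
     -d, -s, -d, -s, -d, -s ]

/-- The singular point `q₃` of the delta manipulator. -/
noncomputable def deltaQ3 (a b d : ℝ) : Fin 15 → ℝ :=
  let q := Real.sqrt (a ^ 2 + 3 * d ^ 2)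
  let s := Real.sqrt (a ^ 2 - d ^ 2)
  let Dm := -(2 * b * q * (a ^ 2 - 3 * d ^ 2)) + q ^ 2 * (a ^ 2 + b ^ 2)
  ![ d * b / q, Real.sqrt 3 * d * b / q, s * b / q,
     d * b / q, -(Real.sqrt 3 * d * b / q), s * b / q,
     2 * b * d * (b * q - 2 * a ^ 2 + b ^ 2 + 3 * d ^ 2)
       / (2 * b * (a ^ 2 - 3 * d ^ 2) - q * (a ^ 2 + b ^ 2)),
     0,
     -(b * s * (2 * b * q - a ^ 2 - b ^ 2 + 6 * d ^ 2)
       / (-(2 * b * (a ^ 2 - 3 * d ^ 2)) + q * (a ^ 2 + b ^ 2))),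
     -d, -s, -d, -s,
     6 * b * d * (a ^ 2 - d ^ 2) * (b - q) / Dm - d,
     6 * b * d ^ 2 * s * (q + 2 * b) / Dm - s ]

/-- A point with `z₁ ≠ 0` whose `y`-coordinates `y₂`, `y₃` differ from `y₁`
has trivial stabilizer in the dihedral group. -/
lemma deltaD3_ne_of_coords {x : Fin 15 → ℝ} (h₂ : x 2 ≠ 0) (h₄ : x 4 ≠ x 1) (h₇ : x 7 ≠ x 1)
    (g : Fin 5) :
    (![deltaR, deltaR ∘ deltaR, deltaS, deltaR ∘ deltaS, deltaR ∘ deltaR ∘ deltaS] g) x ≠ x := by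
  intro h
  fin_cases g
  · exact h₄ (congrFun h 1)
  · exact h₇ (congrFun h 1)
  · exact h₂ (neg_eq_self.mp (congrFun h 2))
  · exact h₄ (congrFun h 1)
  · exact h₇ (congrFun h 1)

/-- The dihedral group `D₃` generated by `R` and `S` acts freely on the orbit of the four
singular points: none of the five non-identity group elements `R, R², S, RS, R²S` fixes
any of `q₁, q₂, q₃, q₄`. -/
theorem delta_D3_acts_freely (a b d : ℝ) (had : a > d) (hd : d > 0) (hb : b > 0) :
    ∀ (g : Fin 5) (i : Fin 4),
      (![deltaR, deltaR ∘ deltaR, deltaS, deltaR ∘ deltaS, deltaR ∘ deltaR ∘ deltaS] g)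
          ((![deltaQ1 a b d, deltaQ2 a b d, deltaQ3 a b d, deltaQ4 a b d]) i)
        ≠ (![deltaQ1 a b d, deltaQ2 a b d, deltaQ3 a b d, deltaQ4 a b d]) i := by
  have hy : 0 < √3 * d * b / √(a ^ 2 + 3 * d ^ 2) := by positivity
  have hs : 0 < √(a ^ 2 - d ^ 2) := Real.sqrt_pos.mpr (by nlinarith)
  have hz : √(a ^ 2 - d ^ 2) * b / √(a ^ 2 + 3 * d ^ 2) ≠ 0 := by positivity
  intro g i
  fin_cases i
  · exact deltaD3_ne_of_coords (x := deltaQ1 a b d) hz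
      (((neg_neg_of_pos hy).trans hy).ne') (neg_neg_of_pos hy).ne' g
  · exact deltaD3_ne_of_coords (x := deltaQ2 a b d) hz
      (((neg_neg_of_pos hy).trans hy).ne) hy.ne g
  · exact deltaD3_ne_of_coords (x := deltaQ3 a b d) hz
      (((neg_neg_of_pos hy).trans hy).ne) hy.ne g
  · exact deltaD3_ne_of_coords (x := deltaQ4 a b d) hz
      (((neg_neg_of_pos hy).trans hy).ne') (neg_neg_of_pos hy).ne' g
end

section
/- Suppose a > d > 0 and b > 0. Then there exist ε > 0 and four real-analytic curves γ₁, γ₂, γ₃, γ₄ : (−ε, ε) → ℝ^15 such that F(γⱼ(t)) = 0 for all t ∈ (−ε, ε) and all j, γⱼ(0) = q₁ for all j, and the four tangent vectors γ₁'(0), γ₂'(0), γ₃'(0), γ₄'(0) are linearly independent in ℝ^15. -/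
open Real

/-- The configuration whose end effector is displaced by `(x, y, z)` from the common knee point
`(0, 0, s)`, and whose first and second elbow arms are displaced by `(k, l)` and `(k', l')` from
`(-d, s)`. -/
noncomputable def deltaConf (d s x y z k l k' l' : ℝ) : Fin 15 → ℝ :=
  ![ x - k, y, z - l,
     -x / 2 + √3 / 2 * y - k', -(√3 / 2) * x - y / 2, z - l',
     -x / 2 - √3 / 2 * y, √3 / 2 * x - y / 2, z,
     -d + k, s + l, -d + k', s + l', -d, s ]

theorem deltaF_deltaConf {a b d s x y z k l k' l' : ℝ} (hs : s ^ 2 = a ^ 2 - d ^ 2)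
    (hsphere : x ^ 2 + y ^ 2 + z ^ 2 = b ^ 2)
    (hcirc : k ^ 2 + l ^ 2 = 2 * (d * k - s * l))
    (hcirc' : k' ^ 2 + l' ^ 2 = 2 * (d * k' - s * l'))
    (hdist : 2 * (x * k + z * l) = k ^ 2 + l ^ 2)
    (hdist' : 2 * ((-x / 2 + √3 / 2 * y) * k' + z * l') = k' ^ 2 + l' ^ 2) :
    deltaF a b d (deltaConf d s x y z k l k' l') = 0 := by
  have h3 : √3 ^ 2 = 3 := Real.sq_sqrt (by norm_num)
  ext i
  fin_cases i <;> simp [deltaF, deltaConf]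
  · linear_combination hsphere - hdist
  · linear_combination hsphere - hdist' + (x ^ 2 + y ^ 2) / 4 * h3
  · linear_combination hsphere + (x ^ 2 + y ^ 2) / 4 * h3
  · linear_combination hs + hcirc
  · linear_combination hs + hcirc'
  · linear_combination hs
  · linear_combination -x / 4 * h3
  · linear_combination -y / 4 * h3
  · linear_combination -x / 4 * h3
  · linear_combination -y / 4 * h3

theorem analyticAt_deltaConf (d s : ℝ) {x y z k l k' l' : ℝ → ℝ} {t : ℝ}
    (hx : AnalyticAt ℝ x t) (hy : AnalyticAt ℝ y t) (hz : AnalyticAt ℝ z t)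
    (hk : AnalyticAt ℝ k t) (hl : AnalyticAt ℝ l t)
    (hk' : AnalyticAt ℝ k' t) (hl' : AnalyticAt ℝ l' t) :
    AnalyticAt ℝ (fun u => deltaConf d s (x u) (y u) (z u) (k u) (l u) (k' u) (l' u)) t := by
  refine AnalyticAt.pi fun i => ?_
  fin_cases i <;> simp [deltaConf] <;> fun_prop

/-- The curve keeping all elbows fixed and moving the end effector along a great circle. -/
noncomputable def sphericalPath (d s px py pz ux uy uz t : ℝ) : Fin 15 → ℝ :=
  deltaConf d s (cos t * px + sin t * ux) (cos t * py + sin t * uy) (cos t * pz + sin t * uz)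
    0 0 0 0

theorem analyticAt_sphericalPath (d s px py pz ux uy uz t : ℝ) :
    AnalyticAt ℝ (sphericalPath d s px py pz ux uy uz) t := by
  have hsin : AnalyticAt ℝ sin t := analyticAt_sin
  have hcos : AnalyticAt ℝ cos t := analyticAt_cos
  apply analyticAt_deltaConf <;> fun_prop

theorem deltaF_sphericalPath {a b d s px py pz ux uy uz : ℝ} (hs : s ^ 2 = a ^ 2 - d ^ 2)
    (hp : px ^ 2 + py ^ 2 + pz ^ 2 = b ^ 2) (hu : ux ^ 2 + uy ^ 2 + uz ^ 2 = b ^ 2)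
    (hpu : px * ux + py * uy + pz * uz = 0) (t : ℝ) :
    deltaF a b d (sphericalPath d s px py pz ux uy uz t) = 0 := by
  refine deltaF_deltaConf hs ?_ (by ring) (by ring) (by ring) (by ring)
  linear_combination cos t ^ 2 * hp + sin t ^ 2 * hu + 2 * sin t * cos t * hpu
    + b ^ 2 * sin_sq_add_cos_sq t

/-- The `x`-component of the unit chord direction of the elbow circle scaled by its radius, for
an elbow turned by the angle `2 * t` from `(-d, s)`. -/
noncomputable def chordX (d s t : ℝ) : ℝ := -(cos t * s) + sin t * d

/-- The `z`-component of the chord direction whose `x`-component is `chordX`. -/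
noncomputable def chordZ (d s t : ℝ) : ℝ := -(cos t * d) - sin t * s

/-- The `x`-component of the direction from the centre of the elbow circle to the midpoint of the
chord, scaled by the radius. -/
noncomputable def midX (d s t : ℝ) : ℝ := -(cos t * d) - sin t * s

/-- The `z`-component of the midpoint direction whose `x`-component is `midX`. -/
noncomputable def midZ (d s t : ℝ) : ℝ := cos t * s - sin t * d

/-- The factor keeping the end effector at distance `b` from both ends of the chord. -/
noncomputable def chordScale (a b t : ℝ) : ℝ := √(1 - (a / b * sin t) ^ 2)

/-- The first coordinate of the leg while its elbow turns by `2 * t`. -/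
noncomputable def legX (a b d s q t : ℝ) : ℝ :=
  sin t * chordX d s t + chordScale a b t * (b / q * midX d s t)

/-- The second coordinate of the leg while its elbow turns by `2 * t`. -/
noncomputable def legY (a b d q t : ℝ) : ℝ := chordScale a b t * (√3 * d * b / q)

/-- The third coordinate of the leg while its elbow turns by `2 * t`. -/
noncomputable def legZ (a b d s q t : ℝ) : ℝ :=
  sin t * chordZ d s t + chordScale a b t * (b / q * midZ d s t)

/-- The curve along which only the first elbow turns. -/
noncomputable def firstElbowPath (a b d s q t : ℝ) : Fin 15 → ℝ :=
  deltaConf d s (legX a b d s q t) (-legY a b d q t) (legZ a b d s q t)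
    (2 * sin t * chordX d s t) (2 * sin t * chordZ d s t) 0 0

/-- The curve along which only the second elbow turns. -/
noncomputable def secondElbowPath (a b d s q t : ℝ) : Fin 15 → ℝ :=
  deltaConf d s (-legX a b d s q t / 2 - √3 / 2 * legY a b d q t)
    (√3 / 2 * legX a b d s q t - legY a b d q t / 2) (legZ a b d s q t)
    0 0 (2 * sin t * chordX d s t) (2 * sin t * chordZ d s t)

theorem one_sub_sq_pos_of_mem_Ioo {a b t : ℝ} (ha : 0 < a) (hb : 0 < b)
    (ht : t ∈ Set.Ioo (-(b / a)) (b / a)) : 0 < 1 - (a / b * sin t) ^ 2 := by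
  have h1 : |sin t| < b / a := lt_of_le_of_lt abs_sin_le_abs (abs_lt.2 ht)
  have h2 : |a / b * sin t| < 1 := by
    rw [abs_mul, abs_of_pos (div_pos ha hb)]
    calc a / b * |sin t| < a / b * (b / a) := by gcongr
      _ = 1 := by field_simp
  have := (sq_lt_one_iff_abs_lt_one _).2 h2
  linarith

theorem analyticAt_chordScale {a b t : ℝ} (h : 0 < 1 - (a / b * sin t) ^ 2) :
    AnalyticAt ℝ (chordScale a b) t := by
  have hsin : AnalyticAt ℝ sin t := analyticAt_sin
  have hsqrt : AnalyticAt ℝ (√·) (1 - (a / b * sin t) ^ 2) :=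
    (contDiffAt_sqrt h.ne').analyticAt
  exact hsqrt.comp (f := fun t => 1 - (a / b * sin t) ^ 2) (by fun_prop)

theorem analyticAt_chordX (d s t : ℝ) : AnalyticAt ℝ (chordX d s) t := by
  have hsin : AnalyticAt ℝ sin t := analyticAt_sin
  have hcos : AnalyticAt ℝ cos t := analyticAt_cos
  unfold chordX
  fun_prop

theorem analyticAt_chordZ (d s t : ℝ) : AnalyticAt ℝ (chordZ d s) t := by
  have hsin : AnalyticAt ℝ sin t := analyticAt_sin
  have hcos : AnalyticAt ℝ cos t := analyticAt_cos
  unfold chordZ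
  fun_prop

section Leg

variable {a b d s q t : ℝ}

theorem analyticAt_legX (h : 0 < 1 - (a / b * sin t) ^ 2) :
    AnalyticAt ℝ (legX a b d s q) t := by
  have hsin : AnalyticAt ℝ sin t := analyticAt_sin
  have hcos : AnalyticAt ℝ cos t := analyticAt_cos
  have := analyticAt_chordScale h
  have := analyticAt_chordX d s t
  unfold legX midX
  fun_prop

theorem analyticAt_legY (h : 0 < 1 - (a / b * sin t) ^ 2) :
    AnalyticAt ℝ (legY a b d q) t := by
  have := analyticAt_chordScale h
  unfold legY
  fun_prop

theorem analyticAt_legZ (h : 0 < 1 - (a / b * sin t) ^ 2) :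
    AnalyticAt ℝ (legZ a b d s q) t := by
  have hsin : AnalyticAt ℝ sin t := analyticAt_sin
  have hcos : AnalyticAt ℝ cos t := analyticAt_cos
  have := analyticAt_chordScale h
  have := analyticAt_chordZ d s t
  unfold legZ midZ
  fun_prop

theorem analyticAt_firstElbowPath (h : 0 < 1 - (a / b * sin t) ^ 2) :
    AnalyticAt ℝ (firstElbowPath a b d s q) t := by
  have hsin : AnalyticAt ℝ sin t := analyticAt_sin
  have := analyticAt_chordX d s t
  have := analyticAt_chordZ d s t
  have := analyticAt_legX (d := d) (s := s) (q := q) h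
  have := analyticAt_legY (d := d) (q := q) h
  have := analyticAt_legZ (d := d) (s := s) (q := q) h
  apply analyticAt_deltaConf <;> fun_prop

theorem analyticAt_secondElbowPath (h : 0 < 1 - (a / b * sin t) ^ 2) :
    AnalyticAt ℝ (secondElbowPath a b d s q) t := by
  have hsin : AnalyticAt ℝ sin t := analyticAt_sin
  have := analyticAt_chordX d s t
  have := analyticAt_chordZ d s t
  have := analyticAt_legX (d := d) (s := s) (q := q) h
  have := analyticAt_legY (d := d) (q := q) h
  have := analyticAt_legZ (d := d) (s := s) (q := q) h
  apply analyticAt_deltaConf <;> fun_prop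

theorem chord_sq_add_sq (hs : s ^ 2 = a ^ 2 - d ^ 2) :
    chordX d s t ^ 2 + chordZ d s t ^ 2 = a ^ 2 := by
  unfold chordX chordZ
  linear_combination a ^ 2 * sin_sq_add_cos_sq t + (sin t ^ 2 + cos t ^ 2) * hs

theorem leg_dist (hs : s ^ 2 = a ^ 2 - d ^ 2) :
    legX a b d s q t * chordX d s t + legZ a b d s q t * chordZ d s t = sin t * a ^ 2 := by
  rw [← chord_sq_add_sq (t := t) hs]
  unfold legX legZ chordX chordZ midX midZ
  ring

theorem leg_sphere (hs : s ^ 2 = a ^ 2 - d ^ 2) (hq : q ^ 2 = a ^ 2 + 3 * d ^ 2) (hq0 : q ≠ 0)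
    (hb : b ≠ 0) (h : 0 < 1 - (a / b * sin t) ^ 2) :
    legX a b d s q t ^ 2 + legY a b d q t ^ 2 + legZ a b d s q t ^ 2 = b ^ 2 := by
  have h3 : √3 ^ 2 = 3 := Real.sq_sqrt (by norm_num)
  have hc : chordScale a b t ^ 2 = 1 - (a / b * sin t) ^ 2 := Real.sq_sqrt h.le
  have hchord := chord_sq_add_sq (t := t) hs
  have hmid : midX d s t ^ 2 + midZ d s t ^ 2 = a ^ 2 := by
    unfold midX midZ
    linear_combination a ^ 2 * sin_sq_add_cos_sq t + (sin t ^ 2 + cos t ^ 2) * hs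
  have horth : chordX d s t * midX d s t + chordZ d s t * midZ d s t = 0 := by
    unfold chordX chordZ midX midZ
    ring
  have hbq : (b / q) ^ 2 * q ^ 2 = b ^ 2 := by field_simp
  have hab : b ^ 2 * (a / b * sin t) ^ 2 = a ^ 2 * sin t ^ 2 := by field_simp
  unfold legX legY legZ
  linear_combination sin t ^ 2 * hchord + chordScale a b t ^ 2 * (b / q) ^ 2 * hmid
    + 2 * sin t * chordScale a b t * (b / q) * horth + b ^ 2 * hc - hab
    + chordScale a b t ^ 2 * (b / q) ^ 2 * d ^ 2 * h3
    - chordScale a b t ^ 2 * (b / q) ^ 2 * hq + chordScale a b t ^ 2 * hbq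

theorem chord_circle (hs : s ^ 2 = a ^ 2 - d ^ 2) :
    (2 * sin t * chordX d s t) ^ 2 + (2 * sin t * chordZ d s t) ^ 2
      = 2 * (d * (2 * sin t * chordX d s t) - s * (2 * sin t * chordZ d s t)) := by
  have h : d * chordX d s t - s * chordZ d s t = sin t * a ^ 2 := by
    unfold chordX chordZ
    linear_combination sin t * hs
  linear_combination 4 * sin t ^ 2 * chord_sq_add_sq (t := t) hs - 4 * sin t * h

theorem deltaF_firstElbowPath (hs : s ^ 2 = a ^ 2 - d ^ 2) (hq : q ^ 2 = a ^ 2 + 3 * d ^ 2)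
    (hq0 : q ≠ 0) (hb : b ≠ 0) (h : 0 < 1 - (a / b * sin t) ^ 2) :
    deltaF a b d (firstElbowPath a b d s q t) = 0 := by
  refine deltaF_deltaConf hs ?_ (chord_circle hs) (by ring) ?_ (by ring)
  · linear_combination leg_sphere hs hq hq0 hb h
  · linear_combination 4 * sin t * leg_dist (b := b) (q := q) (t := t) hs
      - 4 * sin t ^ 2 * chord_sq_add_sq (t := t) hs

theorem deltaF_secondElbowPath (hs : s ^ 2 = a ^ 2 - d ^ 2) (hq : q ^ 2 = a ^ 2 + 3 * d ^ 2)
    (hq0 : q ≠ 0) (hb : b ≠ 0) (h : 0 < 1 - (a / b * sin t) ^ 2) :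
    deltaF a b d (secondElbowPath a b d s q t) = 0 := by
  have h3 : √3 ^ 2 = 3 := Real.sq_sqrt (by norm_num)
  refine deltaF_deltaConf hs ?_ (by ring) (chord_circle hs) (by ring) ?_
  · linear_combination leg_sphere hs hq hq0 hb h
      + (legX a b d s q t ^ 2 + legY a b d q t ^ 2) / 4 * h3
  · linear_combination 4 * sin t * leg_dist (b := b) (q := q) (t := t) hs
      - 4 * sin t ^ 2 * chord_sq_add_sq (t := t) hs
      + sin t * chordX d s t * legX a b d s q t * h3

end Leg

theorem deltaQ1_eq_deltaConf (a b d : ℝ) :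
    deltaQ1 a b d = deltaConf d √(a ^ 2 - d ^ 2) (-(d * b / √(a ^ 2 + 3 * d ^ 2)))
      (-(√3 * d * b / √(a ^ 2 + 3 * d ^ 2))) (√(a ^ 2 - d ^ 2) * b / √(a ^ 2 + 3 * d ^ 2))
      0 0 0 0 := by
  have h3 : √3 ^ 2 = 3 := Real.sq_sqrt (by norm_num)
  generalize hs : √(a ^ 2 - d ^ 2) = s
  generalize hq : √(a ^ 2 + 3 * d ^ 2) = q
  ext i
  fin_cases i <;> simp [deltaQ1, deltaConf, hs, hq]
  · linear_combination d * b / q / 2 * h3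
  · ring
  · linear_combination -(d * b / q / 2) * h3
  · ring

theorem firstElbowPath_zero (a b d s q : ℝ) :
    firstElbowPath a b d s q 0
      = deltaConf d s (-(d * b / q)) (-(√3 * d * b / q)) (s * b / q) 0 0 0 0 := by
  simp only [firstElbowPath, legX, legY, legZ, chordScale, midX, midZ, sin_zero, cos_zero]
  congr 1 <;> norm_num <;> ring

theorem secondElbowPath_zero (a b d s q : ℝ) :
    secondElbowPath a b d s q 0
      = deltaConf d s (-(d * b / q)) (-(√3 * d * b / q)) (s * b / q) 0 0 0 0 := by
  have h3 : √3 ^ 2 = 3 := Real.sq_sqrt (by norm_num)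
  simp only [secondElbowPath, legX, legY, legZ, chordScale, midX, midZ, sin_zero, cos_zero]
  congr 1 <;> norm_num
  · linear_combination -(d * b / q / 2) * h3
  · ring
  · ring

/-- Through the singular point `q₁` there pass four real-analytic curves inside the
configuration space whose tangent vectors at `q₁` are linearly independent. -/
theorem deltaQ1_four_paths (a b d : ℝ) (had : a > d) (hd : d > 0) (hb : b > 0) :
    ∃ ε > (0 : ℝ), ∃ γ : Fin 4 → ℝ → (Fin 15 → ℝ),
      (∀ j, ∀ t ∈ Set.Ioo (-ε) ε, AnalyticAt ℝ (γ j) t ∧ deltaF a b d (γ j t) = 0) ∧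
      (∀ j, γ j 0 = deltaQ1 a b d) ∧
      LinearIndependent ℝ (fun j : Fin 4 => deriv (γ j) 0) := by
  have ha : 0 < a := hd.trans had
  have h3 : √3 ^ 2 = 3 := Real.sq_sqrt (by norm_num)
  have hsd : 0 < a ^ 2 - d ^ 2 := by nlinarith
  obtain ⟨s, hsdef⟩ : ∃ s, s = √(a ^ 2 - d ^ 2) := ⟨_, rfl⟩
  obtain ⟨q, hqdef⟩ : ∃ q, q = √(a ^ 2 + 3 * d ^ 2) := ⟨_, rfl⟩
  have hs0 : 0 < s := hsdef ▸ Real.sqrt_pos.2 hsd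
  have hs : s ^ 2 = a ^ 2 - d ^ 2 := hsdef ▸ Real.sq_sqrt hsd.le
  have hq0 : 0 < q := hqdef ▸ Real.sqrt_pos.2 (by positivity)
  have hq : q ^ 2 = a ^ 2 + 3 * d ^ 2 := hqdef ▸ Real.sq_sqrt (by positivity)
  have hbq : (b / q) ^ 2 * q ^ 2 = b ^ 2 := by field_simp
  have hpos : ∀ {t}, t ∈ Set.Ioo (-(b / a)) (b / a) → 0 < 1 - (a / b * sin t) ^ 2 :=
    one_sub_sq_pos_of_mem_Ioo ha hb
  let γ : Fin 4 → ℝ → Fin 15 → ℝ :=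
    ![sphericalPath d s (-(d * b / q)) (-(√3 * d * b / q)) (s * b / q) (√3 / 2 * b) (-(b / 2)) 0,
      sphericalPath d s (-(d * b / q)) (-(√3 * d * b / q)) (s * b / q)
        (b / q * s / 2) (b / q * (√3 * s) / 2) (2 * (b / q) * d),
      firstElbowPath a b d s q, secondElbowPath a b d s q]
  have hP : (-(d * b / q)) ^ 2 + (-(√3 * d * b / q)) ^ 2 + (s * b / q) ^ 2 = b ^ 2 := by
    linear_combination hbq - (b / q) ^ 2 * hq + (b / q) ^ 2 * d ^ 2 * h3 + (b / q) ^ 2 * hs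
  have han : ∀ j, ∀ t ∈ Set.Ioo (-(b / a)) (b / a), AnalyticAt ℝ (γ j) t := by
    intro j t ht
    fin_cases j
    · exact analyticAt_sphericalPath ..
    · exact analyticAt_sphericalPath ..
    · exact analyticAt_firstElbowPath (hpos ht)
    · exact analyticAt_secondElbowPath (hpos ht)
  have hε : 0 < b / a := div_pos hb ha
  refine ⟨b / a, hε, γ, fun j t ht => ⟨han j t ht, ?_⟩, fun j => ?_, ?_⟩
  · fin_cases j
    · refine deltaF_sphericalPath hs hP ?_ (by ring) t
      linear_combination b ^ 2 / 4 * h3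
    · refine deltaF_sphericalPath hs hP ?_ ?_ t
      · linear_combination hbq - (b / q) ^ 2 * hq + (b / q) ^ 2 * s ^ 2 / 4 * h3
          + (b / q) ^ 2 * hs
      · linear_combination -(b / q) ^ 2 * s * d / 2 * h3
    · exact deltaF_firstElbowPath hs hq hq0.ne' hb.ne' (hpos ht)
    · exact deltaF_secondElbowPath hs hq hq0.ne' hb.ne' (hpos ht)
  · rw [deltaQ1_eq_deltaConf, ← hsdef, ← hqdef]
    fin_cases j
    · simp [γ, sphericalPath]
    · simp [γ, sphericalPath]
    · exact firstElbowPath_zero ..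
    · exact secondElbowPath_zero ..
  · have hderiv : ∀ j i, deriv (γ j) 0 i = deriv (fun t => γ j t i) 0 := fun j i => by
      have hdiff := (han j 0 ⟨by linarith, hε⟩).differentiableAt
      rw [deriv_pi fun i => differentiableAt_pi.1 hdiff i]
    have hsin := hasDerivAt_sin 0
    have hsphere : ∀ p u : ℝ, deriv (fun t => cos t * p + sin t * u) 0 = u := fun p u => by simp
    have helbow : deriv (fun t => 2 * sin t * chordX d s t) 0 = -(2 * s) := by
      have hchord := (analyticAt_chordX d s 0).differentiableAt.hasDerivAt
      exact ((hsin.const_mul 2).mul hchord).deriv.trans (by simp [chordX])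
    rw [Fintype.linearIndependent_iff]
    intro g hg
    have hcoord : ∀ i, g 0 * deriv (fun t => γ 0 t i) 0 + g 1 * deriv (fun t => γ 1 t i) 0
        + g 2 * deriv (fun t => γ 2 t i) 0 + g 3 * deriv (fun t => γ 3 t i) 0 = 0 := fun i => by
      simpa [Fin.sum_univ_four, hderiv] using congrFun hg i
    have h2 : g 2 = 0 := by
      simpa [γ, sphericalPath, firstElbowPath, secondElbowPath, deltaConf, helbow, hs0.ne']
        using hcoord 9
    have h3' : g 3 = 0 := by
      simpa [γ, sphericalPath, firstElbowPath, secondElbowPath, deltaConf, helbow, hs0.ne']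
        using hcoord 11
    have h1 : g 1 = 0 := by
      simpa [γ, sphericalPath, deltaConf, hsphere, h2, h3', hb.ne', hq0.ne', hd.ne', -deriv_add]
        using hcoord 2
    have h0 : g 0 = 0 := by
      simpa [γ, sphericalPath, deltaConf, hsphere, h1, h2, h3', hb.ne'] using hcoord 0
    intro j
    fin_cases j <;> assumption
end

section
/- Suppose a > d > 0, b > 0 and b ≠ (3d² − a²)/√(a² + 3d²). Then there exist ε > 0 and four real-analytic curves γ₁, γ₂, γ₃, γ₄ : (−ε, ε) → ℝ^15 such that F(γⱼ(t)) = 0 for all t ∈ (−ε, ε) and all j, γⱼ(0) = q₄ for all j, and the four tangent vectors γ₁'(0), γ₂'(0), γ₃'(0), γ₄'(0) are linearly independent in ℝ^15. -/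
open Real Filter Topology

/-- Squared distance from the axis of the third shoulder to the platform point, in the plane
of the third arm. -/
noncomputable def thirdArmSq (d v₁ v₂ v₃ : ℝ) : ℝ :=
  (-(v₁ / 2) - √3 / 2 * v₂ - d) ^ 2 + v₃ ^ 2

/-- The inner product that the third arm must have with the vector from its shoulder to the
platform point. -/
noncomputable def thirdArmInner (a b d v₁ v₂ v₃ : ℝ) : ℝ :=
  (thirdArmSq d v₁ v₂ v₃ + (√3 / 2 * v₁ - v₂ / 2) ^ 2 + a ^ 2 - b ^ 2) / 2

/-- The radicand in the solution for the third arm. -/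
noncomputable def thirdArmDisc (a b d v₁ v₂ v₃ : ℝ) : ℝ :=
  a ^ 2 * thirdArmSq d v₁ v₂ v₃ - thirdArmInner a b d v₁ v₂ v₃ ^ 2

/-- First coordinate of the third arm. -/
noncomputable def thirdArmCos (a b d v₁ v₂ v₃ : ℝ) : ℝ :=
  (thirdArmInner a b d v₁ v₂ v₃ * (-(v₁ / 2) - √3 / 2 * v₂ - d)
    + √(thirdArmDisc a b d v₁ v₂ v₃) * v₃) / thirdArmSq d v₁ v₂ v₃

/-- Second coordinate of the third arm. -/
noncomputable def thirdArmSin (a b d v₁ v₂ v₃ : ℝ) : ℝ :=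
  (thirdArmInner a b d v₁ v₂ v₃ * v₃
    - √(thirdArmDisc a b d v₁ v₂ v₃) * (-(v₁ / 2) - √3 / 2 * v₂ - d)) / thirdArmSq d v₁ v₂ v₃

/-- The configuration with platform point `(v₁, v₂, v₃)`, first arm `(c₁, s₁)`, second arm
`(c₂, s₂)` and the third arm determined by the platform point. -/
noncomputable def deltaLift (a b d v₁ v₂ v₃ c₁ s₁ c₂ s₂ : ℝ) : Fin 15 → ℝ :=
  ![v₁ - d - c₁, v₂, v₃ - s₁,
    -(v₁ / 2) + √3 / 2 * v₂ - d - c₂, -(√3 / 2 * v₁) - v₂ / 2, v₃ - s₂,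
    -(v₁ / 2) - √3 / 2 * v₂ - d - thirdArmCos a b d v₁ v₂ v₃, √3 / 2 * v₁ - v₂ / 2,
    v₃ - thirdArmSin a b d v₁ v₂ v₃,
    c₁, s₁, c₂, s₂, thirdArmCos a b d v₁ v₂ v₃, thirdArmSin a b d v₁ v₂ v₃]

theorem thirdArm_norm {a b d v₁ v₂ v₃ : ℝ} (hr : 0 < thirdArmSq d v₁ v₂ v₃)
    (hD : 0 < thirdArmDisc a b d v₁ v₂ v₃) :
    thirdArmCos a b d v₁ v₂ v₃ ^ 2 + thirdArmSin a b d v₁ v₂ v₃ ^ 2 = a ^ 2 := by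
  have hk := Real.sq_sqrt hD.le
  have hR : (-(v₁ / 2) - √3 / 2 * v₂ - d) ^ 2 + v₃ ^ 2 = thirdArmSq d v₁ v₂ v₃ := rfl
  have hd : thirdArmDisc a b d v₁ v₂ v₃
    = a ^ 2 * thirdArmSq d v₁ v₂ v₃ - thirdArmInner a b d v₁ v₂ v₃ ^ 2 := rfl
  rw [thirdArmCos, thirdArmSin, div_pow, div_pow, ← add_div, div_eq_iff (by positivity)]
  linear_combination (thirdArmInner a b d v₁ v₂ v₃ ^ 2 + √(thirdArmDisc a b d v₁ v₂ v₃) ^ 2) * hR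
    + thirdArmSq d v₁ v₂ v₃ * (hk + hd)

theorem thirdArm_inner {a b d v₁ v₂ v₃ : ℝ} (hr : 0 < thirdArmSq d v₁ v₂ v₃) :
    thirdArmCos a b d v₁ v₂ v₃ * (-(v₁ / 2) - √3 / 2 * v₂ - d)
      + thirdArmSin a b d v₁ v₂ v₃ * v₃ = thirdArmInner a b d v₁ v₂ v₃ := by
  have hR : (-(v₁ / 2) - √3 / 2 * v₂ - d) ^ 2 + v₃ ^ 2 = thirdArmSq d v₁ v₂ v₃ := rfl
  rw [thirdArmCos, thirdArmSin, div_mul_eq_mul_div _ _ (_ - d), div_mul_eq_mul_div _ _ v₃,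
    ← add_div, div_eq_iff hr.ne']
  linear_combination thirdArmInner a b d v₁ v₂ v₃ * hR

theorem deltaF_deltaLift {a b d v₁ v₂ v₃ c₁ s₁ c₂ s₂ : ℝ}
    (hr : 0 < thirdArmSq d v₁ v₂ v₃) (hD : 0 < thirdArmDisc a b d v₁ v₂ v₃)
    (h₁ : c₁ ^ 2 + s₁ ^ 2 = a ^ 2) (h₂ : c₂ ^ 2 + s₂ ^ 2 = a ^ 2)
    (h₃ : (v₁ - d - c₁) ^ 2 + v₂ ^ 2 + (v₃ - s₁) ^ 2 = b ^ 2)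
    (h₄ : (-(v₁ / 2) + √3 / 2 * v₂ - d - c₂) ^ 2 + (-(√3 / 2 * v₁) - v₂ / 2) ^ 2
      + (v₃ - s₂) ^ 2 = b ^ 2) :
    deltaF a b d (deltaLift a b d v₁ v₂ v₃ c₁ s₁ c₂ s₂) = 0 := by
  have hn := thirdArm_norm hr hD
  have hi := thirdArm_inner (a := a) (b := b) hr
  have hR : (-(v₁ / 2) - √3 / 2 * v₂ - d) ^ 2 + v₃ ^ 2 = thirdArmSq d v₁ v₂ v₃ := rfl
  have hI : thirdArmInner a b d v₁ v₂ v₃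
    = (thirdArmSq d v₁ v₂ v₃ + (√3 / 2 * v₁ - v₂ / 2) ^ 2 + a ^ 2 - b ^ 2) / 2 := rfl
  have h3 : √(3 : ℝ) ^ 2 = 3 := Real.sq_sqrt (by norm_num)
  have h₅ : (-(v₁ / 2) - √3 / 2 * v₂ - d - thirdArmCos a b d v₁ v₂ v₃) ^ 2
      + (√3 / 2 * v₁ - v₂ / 2) ^ 2 + (v₃ - thirdArmSin a b d v₁ v₂ v₃) ^ 2 = b ^ 2 := by
    linear_combination hR + hn - 2 * hi - 2 * hI
  funext i
  fin_cases i <;> simp [deltaF, deltaLift]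
  · linear_combination h₃
  · linear_combination h₄
  · linear_combination h₅
  · linear_combination h₁
  · linear_combination h₂
  · linear_combination hn
  · linear_combination (-(v₁ / 4)) * h3
  · linear_combination (-(v₂ / 4)) * h3
  · linear_combination (-(v₁ / 4)) * h3
  · linear_combination (-(v₂ / 4)) * h3

theorem AnalyticAt.real_sqrt {f : ℝ → ℝ} {t : ℝ} (hf : AnalyticAt ℝ f t) (h : 0 < f t) :
    AnalyticAt ℝ (fun u => √(f u)) t :=
  ((Real.contDiffAt_sqrt (n := ⊤) h.ne').analyticAt).comp hf

theorem analyticAt_deltaLift {a b d t : ℝ} {v₁ v₂ v₃ c₁ s₁ c₂ s₂ : ℝ → ℝ}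
    (hv₁ : AnalyticAt ℝ v₁ t) (hv₂ : AnalyticAt ℝ v₂ t) (hv₃ : AnalyticAt ℝ v₃ t)
    (hc₁ : AnalyticAt ℝ c₁ t) (hs₁ : AnalyticAt ℝ s₁ t)
    (hc₂ : AnalyticAt ℝ c₂ t) (hs₂ : AnalyticAt ℝ s₂ t)
    (hr : 0 < thirdArmSq d (v₁ t) (v₂ t) (v₃ t))
    (hD : 0 < thirdArmDisc a b d (v₁ t) (v₂ t) (v₃ t)) :
    AnalyticAt ℝ (fun u => deltaLift a b d (v₁ u) (v₂ u) (v₃ u) (c₁ u) (s₁ u) (c₂ u) (s₂ u)) t := by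
  have ar : AnalyticAt ℝ (fun u => thirdArmSq d (v₁ u) (v₂ u) (v₃ u)) t := by
    unfold thirdArmSq; fun_prop
  have ai : AnalyticAt ℝ (fun u => thirdArmInner a b d (v₁ u) (v₂ u) (v₃ u)) t := by
    unfold thirdArmInner; fun_prop
  have ak : AnalyticAt ℝ (fun u => √(thirdArmDisc a b d (v₁ u) (v₂ u) (v₃ u))) t := by
    refine AnalyticAt.real_sqrt ?_ hD
    unfold thirdArmDisc; fun_prop
  have ac : AnalyticAt ℝ (fun u => thirdArmCos a b d (v₁ u) (v₂ u) (v₃ u)) t := by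
    unfold thirdArmCos; exact AnalyticAt.fun_div (by fun_prop) ar hr.ne'
  have a_sin : AnalyticAt ℝ (fun u => thirdArmSin a b d (v₁ u) (v₂ u) (v₃ u)) t := by
    unfold thirdArmSin; exact AnalyticAt.fun_div (by fun_prop) ar hr.ne'
  refine analyticAt_pi_iff.2 fun i => ?_
  fin_cases i <;> simp [deltaLift] <;> fun_prop

theorem thirdArmSq_base (d s β : ℝ) :
    thirdArmSq d (-(d * β)) (-(√3 * d * β)) (s + s * β)
      = d ^ 2 * (2 * β - 1) ^ 2 + s ^ 2 * (1 + β) ^ 2 := by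
  have h3 : √(3 : ℝ) ^ 2 = 3 := Real.sq_sqrt (by norm_num)
  have hR : -(-(d * β) / 2) - √3 / 2 * (-(√3 * d * β)) - d = d * (2 * β - 1) := by
    linear_combination d * β / 2 * h3
  rw [thirdArmSq, hR]
  ring

theorem thirdArmInner_base {a d q s : ℝ} (hq : q ^ 2 = a ^ 2 + 3 * d ^ 2)
    (hs : s ^ 2 = a ^ 2 - d ^ 2) (β : ℝ) :
    thirdArmInner a (β * q) d (-(d * β)) (-(√3 * d * β)) (s + s * β)
      = a ^ 2 + β * (a ^ 2 - 3 * d ^ 2) := by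
  rw [thirdArmInner, thirdArmSq_base]
  linear_combination (-(β ^ 2) / 2) * hq + (1 + β) ^ 2 / 2 * hs

theorem thirdArmDisc_base {a d q s : ℝ} (hq : q ^ 2 = a ^ 2 + 3 * d ^ 2)
    (hs : s ^ 2 = a ^ 2 - d ^ 2) (β : ℝ) :
    thirdArmDisc a (β * q) d (-(d * β)) (-(√3 * d * β)) (s + s * β) = (3 * d * s * β) ^ 2 := by
  have ha : a ^ 2 = s ^ 2 + d ^ 2 := by linear_combination -hs
  rw [thirdArmDisc, thirdArmSq_base, thirdArmInner_base hq hs, ha]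
  ring

theorem thirdArmSq_base_pos {d s β : ℝ} (hs : 0 < s) (hβ : 0 < β) :
    0 < thirdArmSq d (-(d * β)) (-(√3 * d * β)) (s + s * β) := by
  rw [thirdArmSq_base]
  positivity

theorem deltaLift_base {a d q s β : ℝ} (hd : 0 < d) (hβ : 0 < β)
    (hq0 : 0 < q) (hs0 : 0 < s)
    (hq : q = √(a ^ 2 + 3 * d ^ 2)) (hs : s = √(a ^ 2 - d ^ 2))
    (hq2 : q ^ 2 = a ^ 2 + 3 * d ^ 2) (hs2 : s ^ 2 = a ^ 2 - d ^ 2) :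
    deltaLift a (β * q) d (-(d * β)) (-(√3 * d * β)) (s + s * β) (-d) s (-d) s
      = deltaQ4 a (β * q) d := by
  have ha : a ^ 2 = s ^ 2 + d ^ 2 := by linear_combination -hs2
  have hq' : q ^ 2 = s ^ 2 + 4 * d ^ 2 := by linear_combination hq2 - hs2
  have h3 : √(3 : ℝ) ^ 2 = 3 := Real.sq_sqrt (by norm_num)
  have hrb := thirdArmSq_base d s β
  have hr : d ^ 2 * (2 * β - 1) ^ 2 + s ^ 2 * (1 + β) ^ 2 ≠ 0 := by positivity
  have hk : √(thirdArmDisc a (β * q) d (-(d * β)) (-(√3 * d * β)) (s + s * β))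
      = 3 * d * s * β := by
    rw [thirdArmDisc_base hq2 hs2, Real.sqrt_sq (by positivity)]
  have hR : -(-(d * β) / 2) - √3 / 2 * (-(√3 * d * β)) - d = d * (2 * β - 1) := by
    linear_combination d * β / 2 * h3
  have hE : 2 * (β * q) * (a ^ 2 - 3 * d ^ 2) + q * (a ^ 2 + (β * q) ^ 2)
      = q * (d ^ 2 * (2 * β - 1) ^ 2 + s ^ 2 * (1 + β) ^ 2) := by
    rw [mul_pow, ha, hq']; ring
  have hDp : 2 * (β * q) * q * (a ^ 2 - 3 * d ^ 2) + q ^ 2 * (a ^ 2 + (β * q) ^ 2)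
      = q ^ 2 * (d ^ 2 * (2 * β - 1) ^ 2 + s ^ 2 * (1 + β) ^ 2) := by
    linear_combination q * hE
  have hc : thirdArmCos a (β * q) d (-(d * β)) (-(√3 * d * β)) (s + s * β)
      = 6 * (β * q) * d * (a ^ 2 - d ^ 2) * (β * q + q)
        / (q ^ 2 * (d ^ 2 * (2 * β - 1) ^ 2 + s ^ 2 * (1 + β) ^ 2)) - d := by
    rw [thirdArmCos, hk, thirdArmInner_base hq2 hs2, hR, hrb, ha]
    field_simp
    ring
  have hsn : thirdArmSin a (β * q) d (-(d * β)) (-(√3 * d * β)) (s + s * β)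
      = 6 * (β * q) * d ^ 2 * s * (q - 2 * (β * q))
        / (q ^ 2 * (d ^ 2 * (2 * β - 1) ^ 2 + s ^ 2 * (1 + β) ^ 2)) + s := by
    rw [thirdArmSin, hk, thirdArmInner_base hq2 hs2, hR, hrb, ha]
    field_simp
    ring
  have hx : 2 * (β * q) * d * (β * q * q + 2 * a ^ 2 - (β * q) ^ 2 - 3 * d ^ 2)
      / (q * (d ^ 2 * (2 * β - 1) ^ 2 + s ^ 2 * (1 + β) ^ 2))
      = 2 * β * d * (β * (s ^ 2 + 4 * d ^ 2) + 2 * (s ^ 2 + d ^ 2)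
        - β ^ 2 * (s ^ 2 + 4 * d ^ 2) - 3 * d ^ 2)
      / (d ^ 2 * (2 * β - 1) ^ 2 + s ^ 2 * (1 + β) ^ 2) := by
    rw [← hq', ha]
    field_simp
  have hz : β * q * s * (2 * (β * q) * q + a ^ 2 + (β * q) ^ 2 - 6 * d ^ 2)
      / (q * (d ^ 2 * (2 * β - 1) ^ 2 + s ^ 2 * (1 + β) ^ 2))
      = β * s * (2 * β * (s ^ 2 + 4 * d ^ 2) + (s ^ 2 + d ^ 2) + β ^ 2 * (s ^ 2 + 4 * d ^ 2)
        - 6 * d ^ 2) / (d ^ 2 * (2 * β - 1) ^ 2 + s ^ 2 * (1 + β) ^ 2) := by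
    rw [← hq', ha]
    field_simp
  have e₁ : d * (β * q) / q = d * β := by field_simp
  have e₂ : √3 * d * (β * q) / q = √3 * d * β := by field_simp
  have e₃ : s * (β * q) / q = s * β := by field_simp
  unfold deltaLift deltaQ4
  simp only [← hq, ← hs, hc, hsn, hE, hDp, e₁, e₂, e₃, hx, hz, hR]
  funext i
  fin_cases i <;> simp
  · linear_combination (-(d * β / 2)) * h3
  · ring
  · rw [ha]
    field_simp
    ring
  · ring
  · field_simp
    ring

theorem eventually_analyticAt_deltaLift {a d q s β : ℝ} (hd : 0 < d) (hβ : 0 < β) (hs0 : 0 < s)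
    (hq2 : q ^ 2 = a ^ 2 + 3 * d ^ 2) (hs2 : s ^ 2 = a ^ 2 - d ^ 2)
    {v₁ v₂ v₃ c₁ s₁ c₂ s₂ : ℝ → ℝ}
    (hv₁ : AnalyticAt ℝ v₁ 0) (hv₂ : AnalyticAt ℝ v₂ 0) (hv₃ : AnalyticAt ℝ v₃ 0)
    (hc₁ : AnalyticAt ℝ c₁ 0) (hs₁ : AnalyticAt ℝ s₁ 0)
    (hc₂ : AnalyticAt ℝ c₂ 0) (hs₂ : AnalyticAt ℝ s₂ 0)
    (b₁ : v₁ 0 = -(d * β)) (b₂ : v₂ 0 = -(√3 * d * β)) (b₃ : v₃ 0 = s + s * β)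
    (h₁ : ∀ᶠ t in 𝓝 0, c₁ t ^ 2 + s₁ t ^ 2 = a ^ 2)
    (h₂ : ∀ᶠ t in 𝓝 0, c₂ t ^ 2 + s₂ t ^ 2 = a ^ 2)
    (h₃ : ∀ᶠ t in 𝓝 0,
      (v₁ t - d - c₁ t) ^ 2 + v₂ t ^ 2 + (v₃ t - s₁ t) ^ 2 = (β * q) ^ 2)
    (h₄ : ∀ᶠ t in 𝓝 0, (-(v₁ t / 2) + √3 / 2 * v₂ t - d - c₂ t) ^ 2
      + (-(√3 / 2 * v₁ t) - v₂ t / 2) ^ 2 + (v₃ t - s₂ t) ^ 2 = (β * q) ^ 2) :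
    ∀ᶠ t in 𝓝 0,
      AnalyticAt ℝ (fun u => deltaLift a (β * q) d (v₁ u) (v₂ u) (v₃ u)
        (c₁ u) (s₁ u) (c₂ u) (s₂ u)) t ∧
      deltaF a (β * q) d (deltaLift a (β * q) d (v₁ t) (v₂ t) (v₃ t)
        (c₁ t) (s₁ t) (c₂ t) (s₂ t)) = 0 := by
  have hr : 0 < thirdArmSq d (v₁ 0) (v₂ 0) (v₃ 0) := by
    rw [b₁, b₂, b₃]; exact thirdArmSq_base_pos hs0 hβ
  have hD : 0 < thirdArmDisc a (β * q) d (v₁ 0) (v₂ 0) (v₃ 0) := by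
    rw [b₁, b₂, b₃, thirdArmDisc_base hq2 hs2]; positivity
  have k₁ := hv₁.continuousAt
  have k₂ := hv₂.continuousAt
  have k₃ := hv₃.continuousAt
  have er : ∀ᶠ t in 𝓝 0, 0 < thirdArmSq d (v₁ t) (v₂ t) (v₃ t) := by
    refine ContinuousAt.eventually_lt (f := fun _ => (0 : ℝ)) continuousAt_const ?_ hr
    unfold thirdArmSq; fun_prop
  have eD : ∀ᶠ t in 𝓝 0, 0 < thirdArmDisc a (β * q) d (v₁ t) (v₂ t) (v₃ t) := by
    refine ContinuousAt.eventually_lt (f := fun _ => (0 : ℝ)) continuousAt_const ?_ hD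
    unfold thirdArmDisc thirdArmInner thirdArmSq; fun_prop
  filter_upwards [(analyticAt_deltaLift hv₁ hv₂ hv₃ hc₁ hs₁ hc₂ hs₂ hr hD).eventually_analyticAt,
    er, eD, h₁, h₂, h₃, h₄] with t ha hr' hD' h₁' h₂' h₃' h₄'
  exact ⟨ha, deltaF_deltaLift hr' hD' h₁' h₂' h₃' h₄'⟩

/-- Scaling factor of the common forearm direction when one arm is turned by `2 * t`. -/
noncomputable def turnScale (a q β t : ℝ) : ℝ := √(β ^ 2 - (a / q * sin t) ^ 2)

theorem turnScale_zero (a q : ℝ) {β : ℝ} (hβ : 0 < β) : turnScale a q β 0 = β := by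
  simp [turnScale, Real.sqrt_sq hβ.le]

theorem analyticAt_turnScale (a q : ℝ) {β : ℝ} (hβ : 0 < β) :
    AnalyticAt ℝ (turnScale a q β) 0 := by
  refine AnalyticAt.real_sqrt ?_ (by simp [hβ])
  fun_prop

theorem eventually_turnScale_sq (a : ℝ) {q β : ℝ} (hq : 0 < q) (hβ : 0 < β) :
    ∀ᶠ t in 𝓝 0, turnScale a q β t ^ 2 * q ^ 2 = β ^ 2 * q ^ 2 - a ^ 2 * sin t ^ 2 := by
  have h : ∀ᶠ t in 𝓝 (0 : ℝ), 0 < β ^ 2 - (a / q * sin t) ^ 2 := by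
    refine ContinuousAt.eventually_lt (f := fun _ => (0 : ℝ)) continuousAt_const ?_ (by simp [hβ])
    fun_prop
  filter_upwards [h] with t ht
  rw [turnScale, Real.sq_sqrt ht.le]
  field_simp

section Turn

variable (a d q s β t : ℝ)

/-- First coordinate of the platform point when the first arm is turned by `2 * t`. -/
noncomputable def turnX : ℝ :=
  sin t * (d * sin t - s * cos t) - turnScale a q β t * (d * cos t + s * sin t)

/-- Second coordinate of the platform point when the first arm is turned by `2 * t`. -/
noncomputable def turnY : ℝ := -(√3 * d * turnScale a q β t)

/-- Third coordinate of the platform point when the first arm is turned by `2 * t`. -/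
noncomputable def turnZ : ℝ :=
  s - sin t * (s * sin t + d * cos t) + turnScale a q β t * (s * cos t - d * sin t)

/-- First coordinate of the arm `(-d, s)` turned by `2 * t`. -/
noncomputable def turnCos : ℝ := -(d * (cos t ^ 2 - sin t ^ 2)) - 2 * s * sin t * cos t

/-- Second coordinate of the arm `(-d, s)` turned by `2 * t`. -/
noncomputable def turnSin : ℝ := s * (cos t ^ 2 - sin t ^ 2) - 2 * d * sin t * cos t

theorem turn_norm : turnCos d s t ^ 2 + turnSin d s t ^ 2 = d ^ 2 + s ^ 2 := by
  rw [turnCos, turnSin]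
  linear_combination (d ^ 2 + s ^ 2) * (sin t ^ 2 + cos t ^ 2 + 1) * Real.sin_sq_add_cos_sq t

variable {a d q s β t}

theorem turn_forearm_moving (hq2 : q ^ 2 = a ^ 2 + 3 * d ^ 2) (hs2 : s ^ 2 = a ^ 2 - d ^ 2)
    (hK : turnScale a q β t ^ 2 * q ^ 2 = β ^ 2 * q ^ 2 - a ^ 2 * sin t ^ 2) :
    (turnX a d q s β t - d - turnCos d s t) ^ 2 + turnY a d q β t ^ 2
      + (turnZ a d q s β t - turnSin d s t) ^ 2 = (β * q) ^ 2 := by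
  have h3 : √(3 : ℝ) ^ 2 = 3 := Real.sq_sqrt (by norm_num)
  have h := Real.sin_sq_add_cos_sq t
  have hx : turnX a d q s β t - d - turnCos d s t
      = -(sin t * (d * sin t - s * cos t)) - turnScale a q β t * (d * cos t + s * sin t) := by
    rw [turnX, turnCos]
    linear_combination d * h
  have hz : turnZ a d q s β t - turnSin d s t
      = sin t * (s * sin t + d * cos t) + turnScale a q β t * (s * cos t - d * sin t) := by
    rw [turnZ, turnSin]
    linear_combination -s * h
  rw [hx, hz, turnY]
  linear_combination (sin t ^ 2 + turnScale a q β t ^ 2) * (d ^ 2 + s ^ 2) * h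
    + sin t ^ 2 * hs2 + turnScale a q β t ^ 2 * (hs2 - hq2) + hK
    + turnScale a q β t ^ 2 * d ^ 2 * h3

theorem turn_forearm_fixed (hq2 : q ^ 2 = a ^ 2 + 3 * d ^ 2) (hs2 : s ^ 2 = a ^ 2 - d ^ 2)
    (hK : turnScale a q β t ^ 2 * q ^ 2 = β ^ 2 * q ^ 2 - a ^ 2 * sin t ^ 2) :
    turnX a d q s β t ^ 2 + turnY a d q β t ^ 2 + (turnZ a d q s β t - s) ^ 2
      = (β * q) ^ 2 := by
  have h3 : √(3 : ℝ) ^ 2 = 3 := Real.sq_sqrt (by norm_num)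
  have h := Real.sin_sq_add_cos_sq t
  rw [turnX, turnY, turnZ]
  linear_combination (sin t ^ 2 + turnScale a q β t ^ 2) * (d ^ 2 + s ^ 2) * h
    + sin t ^ 2 * hs2 + turnScale a q β t ^ 2 * (hs2 - hq2) + hK
    + turnScale a q β t ^ 2 * d ^ 2 * h3

end Turn

/-- Four paths through the configuration `q₄`: the first two move the forearms with the first two
arms fixed, the last two turn the first, respectively the second, arm. -/
noncomputable def deltaPath (a d q s β : ℝ) : Fin 4 → ℝ → Fin 15 → ℝ :=
  ![fun t => deltaLift a (β * q) d (β * (√3 * d * sin t - d * cos t))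
      (-(β * (√3 * d * cos t + d * sin t))) (s + s * β) (-d) s (-d) s,
    fun t => deltaLift a (β * q) d (-(β / 2 * (2 * d * cos t - s * sin t)))
      (-(√3 * (β / 2 * (2 * d * cos t - s * sin t)))) (s + β * (s * cos t + 2 * d * sin t))
      (-d) s (-d) s,
    fun t => deltaLift a (β * q) d (turnX a d q s β t) (turnY a d q β t) (turnZ a d q s β t)
      (turnCos d s t) (turnSin d s t) (-d) s,
    fun t => deltaLift a (β * q) d (-(turnX a d q s β t / 2) + √3 / 2 * turnY a d q β t)
      (√3 / 2 * turnX a d q s β t + turnY a d q β t / 2) (turnZ a d q s β t)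
      (-d) s (turnCos d s t) (turnSin d s t)]

theorem eventually_deltaPath {a d q s β : ℝ} (hd : 0 < d) (hβ : 0 < β) (hq0 : 0 < q) (hs0 : 0 < s)
    (hq2 : q ^ 2 = a ^ 2 + 3 * d ^ 2) (hs2 : s ^ 2 = a ^ 2 - d ^ 2) (j : Fin 4) :
    ∀ᶠ t in 𝓝 0, AnalyticAt ℝ (deltaPath a d q s β j) t ∧
      deltaF a (β * q) d (deltaPath a d q s β j t) = 0 := by
  have h3 : √(3 : ℝ) ^ 2 = 3 := Real.sq_sqrt (by norm_num)
  have ha : (-d) ^ 2 + s ^ 2 = a ^ 2 := by linear_combination hs2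
  have hturn (t : ℝ) : turnCos d s t ^ 2 + turnSin d s t ^ 2 = a ^ 2 := by
    rw [turn_norm]; linear_combination hs2
  have hK := eventually_turnScale_sq a hq0 hβ
  have aK := analyticAt_turnScale a q hβ
  have aX : AnalyticAt ℝ (turnX a d q s β) 0 := by unfold turnX; fun_prop
  have aY : AnalyticAt ℝ (turnY a d q β) 0 := by unfold turnY; fun_prop
  have aZ : AnalyticAt ℝ (turnZ a d q s β) 0 := by unfold turnZ; fun_prop
  have aC : AnalyticAt ℝ (turnCos d s) 0 := by unfold turnCos; fun_prop
  have aS : AnalyticAt ℝ (turnSin d s) 0 := by unfold turnSin; fun_prop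
  fin_cases j
  · refine eventually_analyticAt_deltaLift hd hβ hs0 hq2 hs2 (by fun_prop) (by fun_prop)
      (by fun_prop) (by fun_prop) (by fun_prop) (by fun_prop) (by fun_prop)
      (by simp; ring) (by simp; ring) rfl (.of_forall fun _ => ha) (.of_forall fun _ => ha)
      (.of_forall fun t => ?_) (.of_forall fun t => ?_)
    · linear_combination (β ^ 2 * 4 * d ^ 2) * Real.sin_sq_add_cos_sq t + β ^ 2 * (hs2 - hq2)
        + β ^ 2 * d ^ 2 * (sin t ^ 2 + cos t ^ 2) * h3
    · linear_combination (β ^ 2 * 4 * d ^ 2) * Real.sin_sq_add_cos_sq t + β ^ 2 * (hs2 - hq2)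
        + β ^ 2 * d ^ 2 * (sin t ^ 2 + cos t ^ 2) * h3
        + ((β * (√3 * d * sin t - d * cos t)) ^ 2 + (β * (√3 * d * cos t + d * sin t)) ^ 2) / 4 * h3
  · refine eventually_analyticAt_deltaLift hd hβ hs0 hq2 hs2 (by fun_prop) (by fun_prop)
      (by fun_prop) (by fun_prop) (by fun_prop) (by fun_prop) (by fun_prop)
      (by simp; ring) (by simp; ring) (by simp; ring) (.of_forall fun _ => ha)
      (.of_forall fun _ => ha) (.of_forall fun t => ?_) (.of_forall fun t => ?_)
    · linear_combination (β ^ 2 * (s ^ 2 + 4 * d ^ 2)) * Real.sin_sq_add_cos_sq t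
        + β ^ 2 * (hs2 - hq2) + β ^ 2 / 4 * (2 * d * cos t - s * sin t) ^ 2 * h3
    · linear_combination (β ^ 2 * (s ^ 2 + 4 * d ^ 2)) * Real.sin_sq_add_cos_sq t
        + β ^ 2 * (hs2 - hq2) + β ^ 2 / 4 * (2 * d * cos t - s * sin t) ^ 2 * h3
        + (1 + √3 ^ 2) * (β / 2 * (2 * d * cos t - s * sin t)) ^ 2 / 4 * h3
  · refine eventually_analyticAt_deltaLift hd hβ hs0 hq2 hs2 aX aY aZ aC aS (by fun_prop)
      (by fun_prop) (by simp [turnX, turnScale_zero a q hβ]; ring)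
      (by simp [turnY, turnScale_zero a q hβ])
      (by simp [turnZ, turnScale_zero a q hβ]; ring) (.of_forall hturn)
      (.of_forall fun _ => ha) (hK.mono fun t ht => turn_forearm_moving hq2 hs2 ht)
      (hK.mono fun t ht => ?_)
    linear_combination turn_forearm_fixed hq2 hs2 ht
      + (turnX a d q s β t ^ 2 + turnY a d q β t ^ 2) / 4 * h3
  · refine eventually_analyticAt_deltaLift hd hβ hs0 hq2 hs2 (by fun_prop) (by fun_prop) aZ
      (by fun_prop) (by fun_prop) aC aS ?_ ?_
      (by simp [turnZ, turnScale_zero a q hβ]; ring)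
      (.of_forall fun _ => ha) (.of_forall hturn) (hK.mono fun t ht => ?_)
      (hK.mono fun t ht => ?_)
    · simp [turnX, turnY, turnScale_zero a q hβ]
      linear_combination (-(d * β / 2)) * h3
    · simp [turnX, turnY, turnScale_zero a q hβ]
      ring
    · linear_combination turn_forearm_fixed hq2 hs2 ht
        + (turnX a d q s β t ^ 2 + turnY a d q β t ^ 2) / 4 * h3
    · have e₁ : -((-(turnX a d q s β t / 2) + √3 / 2 * turnY a d q β t) / 2)
          + √3 / 2 * (√3 / 2 * turnX a d q s β t + turnY a d q β t / 2)
          = turnX a d q s β t := by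
        linear_combination turnX a d q s β t / 4 * h3
      have e₂ : -(√3 / 2 * (-(turnX a d q s β t / 2) + √3 / 2 * turnY a d q β t))
          - (√3 / 2 * turnX a d q s β t + turnY a d q β t / 2) / 2
          = -turnY a d q β t := by
        linear_combination (-(turnY a d q β t / 4)) * h3
      rw [e₁, e₂, neg_sq]
      exact turn_forearm_moving hq2 hs2 ht

theorem deltaPath_zero {a d q s β : ℝ} (hβ : 0 < β) (j : Fin 4) :
    deltaPath a d q s β j 0
      = deltaLift a (β * q) d (-(d * β)) (-(√3 * d * β)) (s + s * β) (-d) s (-d) s := by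
  have h3 : √(3 : ℝ) ^ 2 = 3 := Real.sq_sqrt (by norm_num)
  have hX : turnX a d q s β 0 = -(d * β) := by simp [turnX, turnScale_zero a q hβ]; ring
  have hY : turnY a d q β 0 = -(√3 * d * β) := by simp [turnY, turnScale_zero a q hβ]
  have hZ : turnZ a d q s β 0 = s + s * β := by simp [turnZ, turnScale_zero a q hβ]; ring
  have hC : turnCos d s 0 = -d := by simp [turnCos]
  have hS : turnSin d s 0 = s := by simp [turnSin]
  fin_cases j <;> simp only [deltaPath, Fin.zero_eta, Fin.mk_one, Fin.reduceFinMk,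
    Matrix.cons_val, hX, hY, hZ, hC, hS, Real.sin_zero, Real.cos_zero]
  · congr 1 <;> ring
  · congr 1 <;> ring
  · congr 1
    · linear_combination (-(d * β / 2)) * h3
    · ring

theorem linearIndependent_deriv_deltaPath {a d q s β : ℝ} (hd : 0 < d) (hβ : 0 < β) (hs0 : 0 < s)
    (hA : ∀ j, AnalyticAt ℝ (deltaPath a d q s β j) 0) :
    LinearIndependent ℝ (fun j => deriv (deltaPath a d q s β j) 0) := by
  have h3 : √(3 : ℝ) ^ 2 = 3 := Real.sq_sqrt (by norm_num)
  have hp (j : Fin 4) (i : Fin 15) {x : ℝ}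
      (hx : HasDerivAt (fun t => deltaPath a d q s β j t i) x 0) :
      deriv (deltaPath a d q s β j) 0 i = x :=
    ((hasDerivAt_pi.1 (hA j).differentiableAt.hasDerivAt) i).unique hx
  have hs := Real.hasDerivAt_sin 0
  have hc := Real.hasDerivAt_cos 0
  have hT : HasDerivAt (turnCos d s) (-(2 * s)) 0 := by
    unfold turnCos
    refine HasDerivAt.congr_deriv ((((hc.pow 2).sub (hs.pow 2)).const_mul d).neg.sub
      ((hs.const_mul (2 * s)).mul hc)) ?_
    simp
  have d09 : deriv (deltaPath a d q s β 0) 0 9 = 0 := hp 0 9 (hasDerivAt_const _ _)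
  have d19 : deriv (deltaPath a d q s β 1) 0 9 = 0 := hp 1 9 (hasDerivAt_const _ _)
  have d29 : deriv (deltaPath a d q s β 2) 0 9 = -(2 * s) := hp 2 9 hT
  have d39 : deriv (deltaPath a d q s β 3) 0 9 = 0 := hp 3 9 (hasDerivAt_const _ _)
  have d0b : deriv (deltaPath a d q s β 0) 0 11 = 0 := hp 0 11 (hasDerivAt_const _ _)
  have d1b : deriv (deltaPath a d q s β 1) 0 11 = 0 := hp 1 11 (hasDerivAt_const _ _)
  have d2b : deriv (deltaPath a d q s β 2) 0 11 = 0 := hp 2 11 (hasDerivAt_const _ _)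
  have d3b : deriv (deltaPath a d q s β 3) 0 11 = -(2 * s) := hp 3 11 hT
  have d00 : deriv (deltaPath a d q s β 0) 0 0 = β * (√3 * d) := by
    refine hp 0 0 ?_
    refine HasDerivAt.congr_deriv (((((hs.const_mul (√3 * d)).sub (hc.const_mul d)).const_mul β).sub_const d).sub_const
      (-d)) ?_
    simp
  have d01 : deriv (deltaPath a d q s β 0) 0 1 = -(β * d) := by
    refine hp 0 1 ?_
    refine HasDerivAt.congr_deriv ((((hc.const_mul (√3 * d)).add (hs.const_mul d)).const_mul β).neg) ?_
    simp
  have d10 : deriv (deltaPath a d q s β 1) 0 0 = β / 2 * s := by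
    refine hp 1 0 ?_
    refine HasDerivAt.congr_deriv ((((((hc.const_mul (2 * d)).sub (hs.const_mul s)).const_mul (β / 2)).neg).sub_const
      d).sub_const (-d)) ?_
    simp
  have d11 : deriv (deltaPath a d q s β 1) 0 1 = √3 * (β / 2 * s) := by
    refine hp 1 1 ?_
    refine HasDerivAt.congr_deriv (((((hc.const_mul (2 * d)).sub (hs.const_mul s)).const_mul (β / 2)).const_mul √3).neg) ?_
    simp
  rw [Fintype.linearIndependent_iff]
  intro g hg
  have hg' (i : Fin 15) := congrFun hg i
  simp only [Fin.sum_univ_four, Pi.add_apply, Pi.smul_apply, smul_eq_mul, Pi.zero_apply] at hg'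
  have e9 := hg' 9
  have eb := hg' 11
  have e0 := hg' 0
  have e1 := hg' 1
  rw [d09, d19, d29, d39] at e9
  rw [d0b, d1b, d2b, d3b] at eb
  have g2 : g 2 = 0 := by
    refine (mul_eq_zero.1 (?_ : g 2 * s = 0)).resolve_right hs0.ne'
    linear_combination (-1 / 2) * e9
  have g3 : g 3 = 0 := by
    refine (mul_eq_zero.1 (?_ : g 3 * s = 0)).resolve_right hs0.ne'
    linear_combination (-1 / 2) * eb
  rw [d00, d10, g2, g3] at e0
  rw [d01, d11, g2, g3] at e1
  have g0 : g 0 = 0 := by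
    refine (mul_eq_zero.1 (?_ : g 0 * (β * d) = 0)).resolve_right (by positivity)
    linear_combination (√3 * e0 - e1) / 4 - g 0 * β * d / 4 * h3
  have g1 : g 1 = 0 := by
    refine (mul_eq_zero.1 (?_ : g 1 * (β * s) = 0)).resolve_right (by positivity)
    rw [g0] at e0
    linear_combination 2 * e0
  intro j
  fin_cases j <;> assumption

/-- Through the singular point `q₄` there pass four real-analytic curves inside the
configuration space whose tangent vectors at `q₄` are linearly independent. -/
theorem deltaQ4_four_paths (a b d : ℝ) (had : a > d) (hd : d > 0) (hb : b > 0)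
    (hbne : b ≠ (3 * d ^ 2 - a ^ 2) / Real.sqrt (a ^ 2 + 3 * d ^ 2)) :
    ∃ ε > (0 : ℝ), ∃ γ : Fin 4 → ℝ → (Fin 15 → ℝ),
      (∀ j, ∀ t ∈ Set.Ioo (-ε) ε, AnalyticAt ℝ (γ j) t ∧ deltaF a b d (γ j t) = 0) ∧
      (∀ j, γ j 0 = deltaQ4 a b d) ∧
      LinearIndependent ℝ (fun j : Fin 4 => deriv (γ j) 0) := by
  have hq0 : 0 < √(a ^ 2 + 3 * d ^ 2) := Real.sqrt_pos.2 (by positivity)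
  have hs0 : 0 < √(a ^ 2 - d ^ 2) := Real.sqrt_pos.2 (by nlinarith)
  have hq2 : √(a ^ 2 + 3 * d ^ 2) ^ 2 = a ^ 2 + 3 * d ^ 2 := Real.sq_sqrt (by positivity)
  have hs2 : √(a ^ 2 - d ^ 2) ^ 2 = a ^ 2 - d ^ 2 := Real.sq_sqrt (by nlinarith)
  obtain ⟨β, rfl⟩ : ∃ β, b = β * √(a ^ 2 + 3 * d ^ 2) :=
    ⟨b / √(a ^ 2 + 3 * d ^ 2), by field_simp⟩
  have hβ : 0 < β := pos_of_mul_pos_left hb hq0.le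
  have hev := eventually_all.2 (eventually_deltaPath hd hβ hq0 hs0 hq2 hs2)
  obtain ⟨ε, hε, h⟩ := Metric.eventually_nhds_iff.1 hev
  refine ⟨ε, hε, deltaPath a d (√(a ^ 2 + 3 * d ^ 2)) (√(a ^ 2 - d ^ 2)) β, fun j t ht => ?_,
    fun j => ?_, ?_⟩
  · exact h (by rw [Real.dist_0_eq_abs]; exact abs_lt.2 ht) j
  · rw [deltaPath_zero hβ, deltaLift_base hd hβ hq0 hs0 rfl rfl hq2 hs2]
  · exact linearIndependent_deriv_deltaPath hd hβ hs0 fun j => (hev.self_of_nhds j).1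
end

section
/- Suppose a > d > 0 and b > 0. Then for every open neighborhood U of q₁ in ℝ^15, the set U ∩ X_{a,b,d} is not a 3-dimensional C¹ embedded submanifold of ℝ^15; in particular, if X_{a,b,d} has local dimension 3 at q₁, then q₁ is not a manifold point of the configuration space X_{a,b,d}. -/
/-- `IsC1Submanifold k S` : the set `S ⊆ ℝⁿ` is a `k`-dimensional `C¹` embedded submanifold
of `ℝⁿ`, in the sense of local straightening charts: around every point of `S` there is a
`C¹` diffeomorphism of open sets of `ℝⁿ` taking `S` to the coordinate subspace
`{y | y i = 0 for i ≥ k}`. -/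
def IsC1Submanifold {n : ℕ} (k : ℕ) (S : Set (Fin n → ℝ)) : Prop :=
  ∀ p ∈ S, ∃ (U W : Set (Fin n → ℝ)) (Φ Ψ : (Fin n → ℝ) → (Fin n → ℝ)),
    IsOpen U ∧ p ∈ U ∧ IsOpen W ∧
    ContDiffOn ℝ 1 Φ U ∧ ContDiffOn ℝ 1 Ψ W ∧
    Set.MapsTo Φ U W ∧ Set.MapsTo Ψ W U ∧
    (∀ x ∈ U, Ψ (Φ x) = x) ∧ (∀ y ∈ W, Φ (Ψ y) = y) ∧
    Φ '' (S ∩ U) = W ∩ {y | ∀ i : Fin n, k ≤ (i : ℕ) → y i = 0}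

/-- The velocities at `p` of the curves in a `k`-dimensional `C¹` submanifold lie in a common
subspace of dimension at most `k`. -/
theorem IsC1Submanifold.exists_submodule_velocities {n k : ℕ} (hk : k ≤ n)
    {S : Set (Fin n → ℝ)} (hS : IsC1Submanifold k S) {p : Fin n → ℝ} (hp : p ∈ S) :
    ∃ T : Submodule ℝ (Fin n → ℝ), Module.finrank ℝ T ≤ k ∧
      ∀ (γ : ℝ → Fin n → ℝ) (v : Fin n → ℝ), HasDerivAt γ v 0 → γ 0 = p →
        (∀ᶠ t in nhds 0, γ t ∈ S) → v ∈ T := by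
  obtain ⟨U, W, Φ, Ψ, hU, hpU, hW, hΦ, hΨ, hΦm, -, hΨΦ, -, himg⟩ := hS p hp
  have hL : HasFDerivAt Φ (fderiv ℝ Φ p) p :=
    ((hΦ.contDiffAt (hU.mem_nhds hpU)).differentiableAt (by simp)).hasFDerivAt
  have hM : HasFDerivAt Ψ (fderiv ℝ Ψ (Φ p)) (Φ p) :=
    ((hΨ.contDiffAt (hW.mem_nhds (hΦm hpU))).differentiableAt (by simp)).hasFDerivAt
  set L := fderiv ℝ Φ p
  set M := fderiv ℝ Ψ (Φ p)
  have hML : M.comp L = ContinuousLinearMap.id ℝ _ := by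
    refine (hM.comp p hL).unique ((hasFDerivAt_id p).congr_of_eventuallyEq ?_)
    filter_upwards [hU.mem_nhds hpU] with x hx using hΨΦ x hx
  have hinj : ∀ x, L x = 0 → x = 0 := fun x hx => by
    have := DFunLike.congr_fun hML x
    simpa [hx] using this.symm
  let T : Submodule ℝ (Fin n → ℝ) :=
    { carrier := {x | ∀ i : Fin n, k ≤ (i : ℕ) → L x i = 0}
      add_mem' := fun {x y} hx hy i hi => by simp [hx i hi, hy i hi]
      zero_mem' := fun i _ => by simp
      smul_mem' := fun c x hx i hi => by simp [hx i hi] }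
  refine ⟨T, ?_, fun γ v hγ h0 hev i hi => ?_⟩
  · let f : T →ₗ[ℝ] (Fin k → ℝ) :=
      (LinearMap.funLeft ℝ ℝ (Fin.castLE hk)).comp (L.toLinearMap.comp T.subtype)
    have hf : Function.Injective f := by
      rw [← LinearMap.ker_eq_bot, LinearMap.ker_eq_bot']
      rintro ⟨x, hx⟩ h
      refine Subtype.ext (hinj x (funext fun i => ?_))
      rcases lt_or_ge (i : ℕ) k with hi | hi
      · exact congrFun h ⟨i, hi⟩
      · exact hx i hi
    simpa using LinearMap.finrank_le_finrank_of_injective hf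
  · subst h0
    have h1 : HasDerivAt (fun t => Φ (γ t) i) (L v i) 0 :=
      hasDerivAt_pi.1 (hL.comp_hasDerivAt (0 : ℝ) hγ) i
    refine h1.unique ((hasDerivAt_const (0 : ℝ) (0 : ℝ)).congr_of_eventuallyEq ?_)
    filter_upwards [hev, hγ.continuousAt.eventually (hU.mem_nhds hpU)] with t ht htU
    exact (himg.subset ⟨γ t, ⟨ht, htU⟩, rfl⟩).2 i hi

/-- The configuration whose platform is at `(p, y, z + s)`, whose first two arms are
`(c₁, s₁)` and `(c₂, s₂)`, and whose third elbow is at `(0, 0, s)`. -/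
noncomputable def deltaPoint (d s p y z c₁ s₁ c₂ s₂ : ℝ) : Fin 15 → ℝ :=
  ![p - d - c₁, y, z + s - s₁,
    -(1 / 2) * p + √3 / 2 * y - d - c₂, -(√3 / 2) * p - 1 / 2 * y, z + s - s₂,
    -(1 / 2) * p - √3 / 2 * y, √3 / 2 * p - 1 / 2 * y, z,
    c₁, s₁, c₂, s₂, -d, s]

theorem deltaF_deltaPoint {a b d s p y z c₁ s₁ c₂ s₂ : ℝ} (hs : s ^ 2 = a ^ 2 - d ^ 2)
    (hw : p ^ 2 + y ^ 2 + z ^ 2 = b ^ 2)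
    (h₁ : c₁ ^ 2 + s₁ ^ 2 = a ^ 2) (h₂ : c₂ ^ 2 + s₂ ^ 2 = a ^ 2)
    (o₁ : (p - d) * (c₁ + d) + (z + s) * (s₁ - s) = 0)
    (o₂ : (-(1 / 2) * p + √3 / 2 * y - d) * (c₂ + d) + (z + s) * (s₂ - s) = 0) :
    deltaF a b d (deltaPoint d s p y z c₁ s₁ c₂ s₂) = 0 := by
  have h3 : √3 ^ 2 = 3 := Real.sq_sqrt (by norm_num)
  funext i
  fin_cases i <;> simp [deltaF, deltaPoint]
  · linear_combination hw + h₁ - hs - 2 * o₁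
  · linear_combination hw + h₂ - hs - 2 * o₂ + (p ^ 2 + y ^ 2) / 4 * h3
  · linear_combination hw + (p ^ 2 + y ^ 2) / 4 * h3
  · linear_combination h₁
  · linear_combination h₂
  · linear_combination hs
  · linear_combination -p / 4 * h3
  · linear_combination -y / 4 * h3
  · linear_combination -p / 4 * h3
  · linear_combination -y / 4 * h3
  · ring

theorem hasDerivAt_deltaPoint {d s t p' y' z' c₁' s₁' c₂' s₂' : ℝ} {p y z c₁ s₁ c₂ s₂ : ℝ → ℝ}
    (hp : HasDerivAt p p' t) (hy : HasDerivAt y y' t) (hz : HasDerivAt z z' t)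
    (hc₁ : HasDerivAt c₁ c₁' t) (hs₁ : HasDerivAt s₁ s₁' t)
    (hc₂ : HasDerivAt c₂ c₂' t) (hs₂ : HasDerivAt s₂ s₂' t) :
    HasDerivAt (fun τ => deltaPoint d s (p τ) (y τ) (z τ) (c₁ τ) (s₁ τ) (c₂ τ) (s₂ τ))
      (deltaPoint 0 0 p' y' z' c₁' s₁' c₂' s₂') t := by
  have hd := hasDerivAt_const t d
  have hs := hasDerivAt_const t s
  refine hasDerivAt_pi.2 fun i => ?_
  fin_cases i
  · exact (hp.sub hd).sub hc₁
  · exact hy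
  · exact (hz.add hs).sub hs₁
  · exact (((hp.const_mul _).add (hy.const_mul _)).sub hd).sub hc₂
  · exact (hp.const_mul _).sub (hy.const_mul _)
  · exact (hz.add hs).sub hs₂
  · exact (hp.const_mul _).sub (hy.const_mul _)
  · exact (hp.const_mul _).sub (hy.const_mul _)
  · exact hz
  · exact hc₁
  · exact hs₁
  · exact hc₂
  · exact hs₂
  · simpa [deltaPoint] using hasDerivAt_const t (-d)
  · exact hs

/-- The first coordinate of the reflection of `(-d, s)` in the line through `(m, k)`. -/
noncomputable def reflFst (d s k m : ℝ) : ℝ :=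
  2 * (-d * m + s * k) * m / (m ^ 2 + k ^ 2) + d

/-- The second coordinate of the reflection of `(-d, s)` in the line through `(m, k)`. -/
noncomputable def reflSnd (d s k m : ℝ) : ℝ :=
  2 * (-d * m + s * k) * k / (m ^ 2 + k ^ 2) - s

theorem reflFst_sq_add_reflSnd_sq (d s m : ℝ) {k : ℝ} (hk : 0 < k) :
    reflFst d s k m ^ 2 + reflSnd d s k m ^ 2 = d ^ 2 + s ^ 2 := by
  have : m ^ 2 + k ^ 2 ≠ 0 := by positivity
  simp only [reflFst, reflSnd]
  field_simp
  ring

theorem refl_orthogonal (d s m : ℝ) {k : ℝ} (hk : 0 < k) :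
    m * (reflFst d s k m + d) + k * (reflSnd d s k m - s) = 0 := by
  have : m ^ 2 + k ^ 2 ≠ 0 := by positivity
  simp only [reflFst, reflSnd]
  field_simp
  ring

theorem reflFst_of_parallel {d s l : ℝ} (hs : 0 < s) (hl : 0 < l) :
    reflFst d s (s * l) (-d * l) = -d := by
  have : (-d * l) ^ 2 + (s * l) ^ 2 ≠ 0 := by positivity
  simp only [reflFst]
  field_simp
  ring

theorem reflSnd_of_parallel {d s l : ℝ} (hs : 0 < s) (hl : 0 < l) :
    reflSnd d s (s * l) (-d * l) = s := by
  have : (-d * l) ^ 2 + (s * l) ^ 2 ≠ 0 := by positivity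
  simp only [reflSnd]
  field_simp
  ring

theorem hasDerivAt_reflFst {d s l : ℝ} (hs : 0 < s) (hl : 0 < l) :
    HasDerivAt (reflFst d s (s * l)) (2 * s ^ 2 / ((d ^ 2 + s ^ 2) * l)) (-d * l) := by
  have hD : (-d * l) ^ 2 + (s * l) ^ 2 ≠ 0 := by positivity
  have hi := hasDerivAt_id (-d * l)
  have h := ((((hi.const_mul (-d)).add_const (s * (s * l))).const_mul 2).mul hi).div
    ((hi.pow 2).add_const ((s * l) ^ 2)) (by simpa using hD) |>.add_const d
  refine h.congr_deriv ?_
  have : d ^ 2 + s ^ 2 ≠ 0 := by positivity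
  simp
  field_simp
  ring

theorem differentiable_reflSnd (d s : ℝ) {k : ℝ} (hk : 0 < k) :
    Differentiable ℝ (reflSnd d s k) := by
  intro m
  have : m ^ 2 + k ^ 2 ≠ 0 := by positivity
  unfold reflSnd
  fun_prop (disch := assumption)

theorem linearIndependent_deltaPoint {p' y' z' p'' y'' z'' c₁ s₁ c₂ s₂ : ℝ} (hz' : z' = 0)
    (hy' : y' ≠ 0) (hz'' : z'' ≠ 0) (hc₁ : c₁ ≠ 0) (hc₂ : c₂ ≠ 0) :
    LinearIndependent ℝ ![deltaPoint 0 0 p' y' z' 0 0 0 0, deltaPoint 0 0 p'' y'' z'' 0 0 0 0,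
      deltaPoint 0 0 p' y' z' c₁ s₁ 0 0, deltaPoint 0 0 p' y' z' 0 0 c₂ s₂] := by
  rw [Fintype.linearIndependent_iff]
  intro g hg
  have e9 := congrFun hg 9
  have e11 := congrFun hg 11
  have e2 := congrFun hg 2
  have e1 := congrFun hg 1
  simp [Fin.sum_univ_four, deltaPoint, hc₁, hc₂, hz'] at e9 e11 e2 e1
  simp [e9] at e2
  simp [hz''] at e2
  simp [e9, e11, e2, hy'] at e1
  intro i
  fin_cases i <;> simp [e1, e2, e9, e11]

theorem deltaQ1_eq_deltaPoint (a b d : ℝ) :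
    deltaQ1 a b d = deltaPoint d √(a ^ 2 - d ^ 2) (-(d * (b / √(a ^ 2 + 3 * d ^ 2))))
      (-(√3 * (d * (b / √(a ^ 2 + 3 * d ^ 2)))))
      (√(a ^ 2 - d ^ 2) * (b / √(a ^ 2 + 3 * d ^ 2)))
      (-d) √(a ^ 2 - d ^ 2) (-d) √(a ^ 2 - d ^ 2) := by
  have h3 : √3 ^ 2 = 3 := Real.sq_sqrt (by norm_num)
  set r := b / √(a ^ 2 + 3 * d ^ 2) with hr
  funext i
  fin_cases i <;> simp [deltaQ1, deltaPoint, mul_div_assoc, ← hr]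
  · ring
  · linear_combination d * r / 2 * h3
  · ring
  · linear_combination -d * r / 2 * h3
  · ring

/-- `q₁` is not a manifold point of the configuration space: no neighborhood of `q₁`
intersects `X_{a,b,d}` in a 3-dimensional `C¹` embedded submanifold of `ℝ¹⁵`. -/
theorem deltaQ1_not_manifold_point (a b d : ℝ) (had : a > d) (hd : d > 0) (hb : b > 0) :
    ∀ U : Set (Fin 15 → ℝ), IsOpen U → deltaQ1 a b d ∈ U →
      ¬ IsC1Submanifold 3 (U ∩ {x | deltaF a b d x = 0}) := by
  intro U hU hqU hS
  have hs : 0 < √(a ^ 2 - d ^ 2) := Real.sqrt_pos.2 (by nlinarith)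
  have hs2 : √(a ^ 2 - d ^ 2) ^ 2 = a ^ 2 - d ^ 2 := Real.sq_sqrt (by nlinarith)
  have hr : 0 < b / √(a ^ 2 + 3 * d ^ 2) := by positivity
  have hr2 : (b / √(a ^ 2 + 3 * d ^ 2)) ^ 2 * (a ^ 2 + 3 * d ^ 2) = b ^ 2 := by
    rw [div_pow, Real.sq_sqrt (by positivity)]
    field_simp
  have hq := deltaQ1_eq_deltaPoint a b d
  set s := √(a ^ 2 - d ^ 2)
  set r := b / √(a ^ 2 + 3 * d ^ 2)
  have h3 : √3 ^ 2 = 3 := Real.sq_sqrt (by norm_num)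
  have hl : 0 < 1 + r := by positivity
  have hk : 0 < s * (1 + r) := by positivity
  have hu : (-d) ^ 2 + s ^ 2 = a ^ 2 := by linarith
  have hsin : HasDerivAt Real.sin 1 0 := by simpa using Real.hasDerivAt_sin 0
  have hcos : HasDerivAt Real.cos 0 0 := by simpa using Real.hasDerivAt_cos 0
  have hconst : ∀ c : ℝ, HasDerivAt (fun _ : ℝ => c) 0 0 := hasDerivAt_const 0
  -- the rotation of the platform about the vertical axis
  let p : ℝ → ℝ := fun t => d * r * (-Real.cos t + √3 * Real.sin t)
  let y : ℝ → ℝ := fun t => d * r * (-(√3 * Real.cos t) - Real.sin t)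
  have hp : HasDerivAt p (d * r * √3) 0 := by
    simpa using (hcos.neg.add (hsin.const_mul √3)).const_mul (d * r)
  have hy : HasDerivAt y (-(d * r)) 0 := by
    simpa using ((hcos.const_mul √3).neg.sub hsin).const_mul (d * r)
  have hw (t : ℝ) : p t ^ 2 + y t ^ 2 + (s * r) ^ 2 = b ^ 2 := by
    linear_combination hr2 + r ^ 2 * hs2 + 4 * d ^ 2 * r ^ 2 * Real.sin_sq_add_cos_sq t +
      d ^ 2 * r ^ 2 * (Real.sin t ^ 2 + Real.cos t ^ 2) * h3
  -- the abscissae of the platform in the planes of the first two legs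
  let m₁ : ℝ → ℝ := fun t => p t - d
  let m₂ : ℝ → ℝ := fun t => -(1 / 2) * p t + √3 / 2 * y t - d
  have hm₁ : HasDerivAt m₁ (d * r * √3) 0 := hp.sub_const d
  have hm₂ : HasDerivAt m₂ (-(d * r * √3)) 0 := by
    refine (((hp.const_mul (-(1 / 2))).add (hy.const_mul (√3 / 2))).sub_const d).congr_deriv ?_
    ring
  have hm₁0 : m₁ 0 = -d * (1 + r) := by
    simp [m₁, p]
    ring
  have hm₂0 : m₂ 0 = -d * (1 + r) := by
    simp [m₂, p, y]
    linear_combination -d * r / 2 * h3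
  have hc {m : ℝ → ℝ} {m' : ℝ} (hm : HasDerivAt m m' 0) (h0 : m 0 = -d * (1 + r)) :
      HasDerivAt (fun t => reflFst d s (s * (1 + r)) (m t))
        (2 * s ^ 2 / ((d ^ 2 + s ^ 2) * (1 + r)) * m') 0 := by
    have h := hasDerivAt_reflFst (d := d) hs hl
    rw [← h0] at h
    exact h.comp (0 : ℝ) hm
  have hsnd {m : ℝ → ℝ} {m' : ℝ} (hm : HasDerivAt m m' 0) :
      HasDerivAt (fun t => reflSnd d s (s * (1 + r)) (m t))
        (deriv (reflSnd d s (s * (1 + r))) (m 0) * m') 0 :=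
    (differentiable_reflSnd d s hk (m 0)).hasDerivAt.comp (0 : ℝ) hm
  -- the tilt of the platform in a vertical plane
  let ρ : ℝ → ℝ := fun t => r * (2 * d * Real.cos t + s * Real.sin t)
  let z : ℝ → ℝ := fun t => r * (s * Real.cos t - 2 * d * Real.sin t)
  have hρ : HasDerivAt ρ (r * s) 0 := by
    simpa using ((hcos.const_mul (2 * d)).add (hsin.const_mul s)).const_mul r
  have hz : HasDerivAt z (r * -(2 * d)) 0 := by
    simpa using ((hcos.const_mul s).sub (hsin.const_mul (2 * d))).const_mul r
  have hwρ (t : ℝ) : (-(1 / 2) * ρ t) ^ 2 + (-(√3 / 2) * ρ t) ^ 2 + z t ^ 2 = b ^ 2 := by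
    linear_combination hr2 + r ^ 2 * hs2 + ρ t ^ 2 / 4 * h3 +
      r ^ 2 * (4 * d ^ 2 + s ^ 2) * Real.sin_sq_add_cos_sq t
  have hqX : deltaF a b d (deltaQ1 a b d) = 0 := by
    rw [hq]
    refine deltaF_deltaPoint hs2 ?_ hu hu (by ring) (by ring)
    linear_combination hr2 + r ^ 2 * hs2 + d ^ 2 * r ^ 2 * h3
  obtain ⟨T, hT, hv⟩ := hS.exists_submodule_velocities (by norm_num) ⟨hqU, hqX⟩
  have hvel {γ : ℝ → Fin 15 → ℝ} {v : Fin 15 → ℝ} (hγ : HasDerivAt γ v 0)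
      (h0 : γ 0 = deltaQ1 a b d) (hX : ∀ t, deltaF a b d (γ t) = 0) : v ∈ T := by
    refine hv γ v hγ h0 ?_
    filter_upwards [hγ.continuousAt.eventually (hU.mem_nhds (h0 ▸ hqU))] with t ht
    exact ⟨ht, hX t⟩
  have hp0 : p 0 = -(d * r) := by simp [p]
  have hy0 : y 0 = -(√3 * (d * r)) := by
    simp [y]
    ring
  have v₁ := hvel (hasDerivAt_deltaPoint (d := d) (s := s) hp hy (hconst (s * r))
    (hconst (-d)) (hconst s) (hconst (-d)) (hconst s)) (by rw [hq, hp0, hy0])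
    fun t => deltaF_deltaPoint hs2 (hw t) hu hu (by ring) (by ring)
  have v₂ := hvel (hasDerivAt_deltaPoint (d := d) (s := s) (hρ.const_mul (-(1 / 2)))
    (hρ.const_mul (-(√3 / 2))) hz (hconst (-d)) (hconst s) (hconst (-d)) (hconst s))
    (by
      rw [hq]
      congr 1 <;> simp [ρ, z] <;> ring)
    fun t => deltaF_deltaPoint hs2 (hwρ t) hu hu (by ring) (by ring)
  have hR (m : ℝ) : reflFst d s (s * (1 + r)) m ^ 2 + reflSnd d s (s * (1 + r)) m ^ 2 = a ^ 2 := by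
    rw [reflFst_sq_add_reflSnd_sq d s m hk]
    linarith
  have v₃ := hvel (hasDerivAt_deltaPoint (d := d) (s := s) hp hy (hconst (s * r))
    (hc hm₁ hm₁0) (hsnd hm₁) (hconst (-d)) (hconst s))
    (by rw [hq, hp0, hy0, hm₁0, reflFst_of_parallel hs hl, reflSnd_of_parallel hs hl])
    fun t => deltaF_deltaPoint hs2 (hw t) (hR _) hu
      (by linear_combination refl_orthogonal d s (m₁ t) hk) (by ring)
  have v₄ := hvel (hasDerivAt_deltaPoint (d := d) (s := s) hp hy (hconst (s * r))
    (hconst (-d)) (hconst s) (hc hm₂ hm₂0) (hsnd hm₂))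
    (by rw [hq, hp0, hy0, hm₂0, reflFst_of_parallel hs hl, reflSnd_of_parallel hs hl])
    fun t => deltaF_deltaPoint hs2 (hw t) hu (hR _) (by ring)
      (by linear_combination refl_orthogonal d s (m₂ t) hk)
  have hli := linearIndependent_deltaPoint (p' := d * r * √3) (y' := -(d * r)) (z' := 0)
    (p'' := -(1 / 2) * (r * s)) (y'' := -(√3 / 2) * (r * s)) (z'' := r * -(2 * d))
    (c₁ := 2 * s ^ 2 / ((d ^ 2 + s ^ 2) * (1 + r)) * (d * r * √3))
    (s₁ := deriv (reflSnd d s (s * (1 + r))) (m₁ 0) * (d * r * √3))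
    (c₂ := 2 * s ^ 2 / ((d ^ 2 + s ^ 2) * (1 + r)) * -(d * r * √3))
    (s₂ := deriv (reflSnd d s (s * (1 + r))) (m₂ 0) * -(d * r * √3)) rfl
    (neg_ne_zero.2 (by positivity)) (mul_ne_zero hr.ne' (neg_ne_zero.2 (by positivity)))
    (by positivity) (mul_ne_zero (by positivity) (neg_ne_zero.2 (by positivity)))
  have hspan := (finrank_span_eq_card hli).ge.trans (Submodule.finrank_mono (t := T)
    (Submodule.span_le.2 (Set.range_subset_iff.2 fun i => by
      fin_cases i
      exacts [v₁, v₂, v₃, v₄])))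
  rw [Fintype.card_fin] at hspan
  omega
end

section
/- Suppose a > d > 0, b > 0 and b ≠ (3d² − a²)/√(a² + 3d²). Then for every open neighborhood U of q₄ in ℝ^15, the set U ∩ X_{a,b,d} is not a 3-dimensional C¹ embedded submanifold of ℝ^15; in particular, if X_{a,b,d} has local dimension 3 at q₄, then q₄ is not a manifold point of the configuration space X_{a,b,d}. -/
/-- A `C¹` submanifold of dimension `k` has, at each of its points `p`, a `k`-dimensional space of
directions `v`, each of which is a limit of difference quotients `u` with `p + t • u ∈ S`. -/
theorem IsC1Submanifold.exists_injective_tangent {n k : ℕ} (hkn : k ≤ n) {S : Set (Fin n → ℝ)}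
    (hS : IsC1Submanifold k S) {p : Fin n → ℝ} (hp : p ∈ S) :
    ∃ L : (Fin k → ℝ) →ₗ[ℝ] (Fin n → ℝ), Function.Injective L ∧
      ∀ y, ((0 : ℝ), L y) ∈ closure {z : ℝ × (Fin n → ℝ) | z.1 ≠ 0 ∧ p + z.1 • z.2 ∈ S} := by
  obtain ⟨U, W, Φ, Ψ, hU, hpU, hW, hΦ, hΨ, hΦm, -, hΨΦ, hΦΨ, himg⟩ := hS p hp
  have hy₀ : Φ p ∈ W := hΦm hpU
  have hΨd : HasFDerivAt Ψ (fderiv ℝ Ψ (Φ p)) (Φ p) :=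
    ((hΨ.contDiffAt (hW.mem_nhds hy₀)).differentiableAt one_ne_zero).hasFDerivAt
  have hΦd : HasFDerivAt Φ (fderiv ℝ Φ p) (Ψ (Φ p)) := by
    rw [hΨΦ p hpU]
    exact ((hΦ.contDiffAt (hU.mem_nhds hpU)).differentiableAt one_ne_zero).hasFDerivAt
  have hid : (fderiv ℝ Φ p).comp (fderiv ℝ Ψ (Φ p)) = ContinuousLinearMap.id ℝ _ := by
    refine (hΦd.comp _ hΨd).unique ((hasFDerivAt_id _).congr_of_eventuallyEq ?_)
    filter_upwards [hW.mem_nhds hy₀] with y hy using hΦΨ y hy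
  have hinj : Function.Injective (fderiv ℝ Ψ (Φ p)) :=
    Function.LeftInverse.injective (g := fderiv ℝ Φ p) fun y => DFunLike.congr_fun hid y
  let ι := Function.ExtendByZero.linearMap ℝ (Fin.castLE hkn)
  have hι : ∀ y (i : Fin n), k ≤ (i : ℕ) → ι y i = 0 := fun y i hi =>
    Function.extend_apply' _ _ _ (by rintro ⟨j, rfl⟩; exact absurd j.2 (not_lt.2 hi))
  have hp₀ : ∀ i : Fin n, k ≤ (i : ℕ) → Φ p i = 0 := by
    have : Φ p ∈ Φ '' (S ∩ U) := ⟨p, ⟨hp, hpU⟩, rfl⟩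
    rw [himg] at this
    exact this.2
  refine ⟨(fderiv ℝ Ψ (Φ p)).toLinearMap ∘ₗ ι,
    hinj.comp (Function.extend_injective (Fin.castLE_injective hkn) _), fun y => ?_⟩
  have hline : HasDerivAt (fun t : ℝ => Φ p + t • ι y) (ι y) 0 := by
    simpa using ((hasDerivAt_id (0 : ℝ)).smul_const (ι y)).const_add (Φ p)
  have hγ : HasDerivAt (fun t : ℝ => Ψ (Φ p + t • ι y)) (fderiv ℝ Ψ (Φ p) (ι y)) 0 :=
    HasFDerivAt.comp_hasDerivAt (0 : ℝ) (by simpa using hΨd) hline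
  have hmem : ∀ᶠ t : ℝ in nhds 0, Φ p + t • ι y ∈ W :=
    hline.continuousAt.eventually_mem (hW.mem_nhds (by simpa using hy₀))
  refine mem_closure_of_tendsto
    ((tendsto_nhdsWithin_of_tendsto_nhds Filter.tendsto_id).prodMk_nhds hγ.tendsto_slope_zero) ?_
  filter_upwards [self_mem_nhdsWithin, nhdsWithin_le_nhds hmem] with t ht htW
  refine ⟨ht, ?_⟩
  obtain ⟨x, ⟨hxS, hxU⟩, hx⟩ : Φ p + t • ι y ∈ Φ '' (S ∩ U) := by
    rw [himg]
    exact ⟨htW, fun i hi => by simp [hι y i hi, hp₀ i hi]⟩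
  have hxp : Ψ (Φ p + t • ι y) = x := by rw [← hx, hΨΦ x hxU]
  simpa [smul_inv_smul₀ (show t ≠ 0 from ht), hΨΦ p hpU, hxp] using hxS

/-- Membership in the zero set of the constraint map, as a list of scalar equations. -/
theorem deltaF_eq_zero_iff (a b d : ℝ) (x : Fin 15 → ℝ) : deltaF a b d x = 0 ↔
    x 0 ^ 2 + x 1 ^ 2 + x 2 ^ 2 = b ^ 2 ∧ x 3 ^ 2 + x 4 ^ 2 + x 5 ^ 2 = b ^ 2 ∧
    x 6 ^ 2 + x 7 ^ 2 + x 8 ^ 2 = b ^ 2 ∧ x 9 ^ 2 + x 10 ^ 2 = a ^ 2 ∧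
    x 11 ^ 2 + x 12 ^ 2 = a ^ 2 ∧ x 13 ^ 2 + x 14 ^ 2 = a ^ 2 ∧
    d + x 9 + x 0 = -(1/2) * (d + x 11 + x 3) - (Real.sqrt 3 / 2) * x 4 ∧
    x 1 = (Real.sqrt 3 / 2) * (d + x 11 + x 3) - (1/2) * x 4 ∧
    x 10 + x 2 = x 12 + x 5 ∧
    d + x 9 + x 0 = -(1/2) * (d + x 13 + x 6) + (Real.sqrt 3 / 2) * x 7 ∧
    x 1 = -(Real.sqrt 3 / 2) * (d + x 13 + x 6) - (1/2) * x 7 ∧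
    x 10 + x 2 = x 14 + x 8 := by
  simp [deltaF, funext_iff, Fin.forall_fin_succ, sub_eq_zero]

/-- The point `q₄` in terms of `β = b / √(a² + 3d²)` and `s = √(a² - d²)`. -/
noncomputable def deltaQ4Param (β d s : ℝ) : Fin 15 → ℝ :=
  let m := (d * (2 * β - 1)) ^ 2 + (s * (β + 1)) ^ 2
  let x := -(2 * β * d * ((β - β ^ 2) * (s ^ 2 + 4 * d ^ 2) + 2 * s ^ 2 - d ^ 2) / m)
  let z := β * s * ((2 * β + β ^ 2) * (s ^ 2 + 4 * d ^ 2) + s ^ 2 - 5 * d ^ 2) / m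
  ![-(β * d), -(Real.sqrt 3 * β * d), β * s, -(β * d), Real.sqrt 3 * β * d, β * s, x, 0, z,
    -d, s, -d, s, 6 * β * (β + 1) * d * s ^ 2 / m - d, 6 * β * (1 - 2 * β) * d ^ 2 * s / m + s]

theorem exists_deltaQ4_eq_deltaQ4Param {a b d : ℝ} (had : d < a) (hd : 0 < d) (hb : 0 < b) :
    ∃ β s : ℝ, 0 < β ∧ 0 < s ∧ a ^ 2 = s ^ 2 + d ^ 2 ∧ b ^ 2 = β ^ 2 * (s ^ 2 + 4 * d ^ 2) ∧
      deltaQ4 a b d = deltaQ4Param β d s := by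
  have hs : 0 < Real.sqrt (a ^ 2 - d ^ 2) := Real.sqrt_pos.2 (by nlinarith)
  have hq : 0 < Real.sqrt (a ^ 2 + 3 * d ^ 2) := Real.sqrt_pos.2 (by positivity)
  have hs2 : a ^ 2 = Real.sqrt (a ^ 2 - d ^ 2) ^ 2 + d ^ 2 := by
    rw [Real.sq_sqrt (by nlinarith)]; ring
  have hq2 : Real.sqrt (a ^ 2 + 3 * d ^ 2) ^ 2 = Real.sqrt (a ^ 2 - d ^ 2) ^ 2 + 4 * d ^ 2 := by
    rw [Real.sq_sqrt (by positivity), Real.sq_sqrt (by nlinarith)]; ring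
  have hbq : b = b / Real.sqrt (a ^ 2 + 3 * d ^ 2) * Real.sqrt (a ^ 2 + 3 * d ^ 2) := by
    field_simp
  have hβ : 0 < b / Real.sqrt (a ^ 2 + 3 * d ^ 2) := by positivity
  refine ⟨b / Real.sqrt (a ^ 2 + 3 * d ^ 2), Real.sqrt (a ^ 2 - d ^ 2), hβ, hs, hs2, ?_, ?_⟩
  · rw [← hq2, ← mul_pow, ← hbq]
  simp only [deltaQ4]
  generalize b / Real.sqrt (a ^ 2 + 3 * d ^ 2) = β at *
  generalize Real.sqrt (a ^ 2 + 3 * d ^ 2) = q at *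
  generalize Real.sqrt (a ^ 2 - d ^ 2) = s at *
  subst hbq
  have hm : 0 < (d * (2 * β - 1)) ^ 2 + (s * (β + 1)) ^ 2 := by positivity
  have hD : 2 * (β * q) * (a ^ 2 - 3 * d ^ 2) + q * (a ^ 2 + (β * q) ^ 2)
      = q * ((d * (2 * β - 1)) ^ 2 + (s * (β + 1)) ^ 2) := by
    rw [mul_pow, hq2, hs2]; ring
  have hDp : 2 * (β * q) * q * (a ^ 2 - 3 * d ^ 2) + q ^ 2 * (a ^ 2 + (β * q) ^ 2)
      = q ^ 2 * ((d * (2 * β - 1)) ^ 2 + (s * (β + 1)) ^ 2) := by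
    linear_combination q * hD
  rw [hD, hDp]
  simp only [deltaQ4Param]
  generalize (d * (2 * β - 1)) ^ 2 + (s * (β + 1)) ^ 2 = m at *
  ext i
  fin_cases i <;> simp <;> field_simp
  · linear_combination 2 * hs2 + (β - β ^ 2) * hq2
  · linear_combination hs2 + (2 * β + β ^ 2) * hq2
  · linear_combination hs2

/-- The third leg of `q₄` is not aligned. -/
theorem deltaQ4Param_leg_three_ne_zero {β d s : ℝ} (hβ : 0 < β) (hd : 0 < d) (hs : 0 < s) :
    deltaQ4Param β d s 6 * deltaQ4Param β d s 14 - deltaQ4Param β d s 8 * deltaQ4Param β d s 13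
      ≠ 0 := by
  have hm : 0 < (d * (2 * β - 1)) ^ 2 + (s * (β + 1)) ^ 2 := by positivity
  have h : deltaQ4Param β d s 6 * deltaQ4Param β d s 14
      - deltaQ4Param β d s 8 * deltaQ4Param β d s 13 = -(3 * β * d * s) := by
    simp [deltaQ4Param]
    field_simp
    ring
  rw [h]
  exact neg_ne_zero.2 (by positivity)

theorem deltaF_deltaQ4Param {a b β d s : ℝ} (hβ : 0 < β) (hs : 0 < s)
    (ha : a ^ 2 = s ^ 2 + d ^ 2) (hb : b ^ 2 = β ^ 2 * (s ^ 2 + 4 * d ^ 2)) :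
    deltaF a b d (deltaQ4Param β d s) = 0 := by
  have hm : 0 < (d * (2 * β - 1)) ^ 2 + (s * (β + 1)) ^ 2 := by positivity
  have h3 : Real.sqrt 3 ^ 2 = 3 := Real.sq_sqrt (by norm_num)
  rw [deltaF_eq_zero_iff, ha, hb]
  simp [deltaQ4Param]
  refine ⟨?_, ?_, ?_, ?_, ?_, ?_, ?_, ?_, ?_⟩
  · linear_combination β ^ 2 * d ^ 2 * h3
  · field_simp
    ring
  · ring
  · field_simp
    ring
  · linear_combination β * d / 2 * h3
  · ring
  · field_simp
    ring
  · field_simp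
    ring
  · field_simp
    ring

/-- A continuous function of `(t, u)` which vanishes, up to a power of `t`, whenever
`p + t • u ∈ S`, also vanishes at limits of difference quotients of `S` at `p`. -/
theorem eq_zero_of_mem_closure {n : ℕ} {S : Set (Fin n → ℝ)} {p v : Fin n → ℝ}
    (hv : ((0 : ℝ), v) ∈ closure {z : ℝ × (Fin n → ℝ) | z.1 ≠ 0 ∧ p + z.1 • z.2 ∈ S})
    {h : ℝ → (Fin n → ℝ) → ℝ} (hh : Continuous (Function.uncurry h)) (j : ℕ)
    (hS : ∀ t u, p + t • u ∈ S → t ^ j * h t u = 0) : h 0 v = 0 := by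
  refine closure_minimal (t := {z | Function.uncurry h z = 0}) ?_
    (isClosed_eq hh continuous_const) hv
  rintro ⟨t, u⟩ ⟨ht, hu⟩
  exact (mul_eq_zero.1 (hS t u hu)).resolve_left (pow_ne_zero j ht)

/-- Limits of difference quotients of the configuration space lie in the kernel of the derivative
of the constraint map. -/
theorem deltaF_linearized {a b d : ℝ} {p v : Fin 15 → ℝ} (hp : deltaF a b d p = 0)
    (hv : ((0 : ℝ), v) ∈
      closure {z : ℝ × (Fin 15 → ℝ) | z.1 ≠ 0 ∧ p + z.1 • z.2 ∈ {x | deltaF a b d x = 0}}) :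
    p 0 * v 0 + p 1 * v 1 + p 2 * v 2 = 0 ∧ p 3 * v 3 + p 4 * v 4 + p 5 * v 5 = 0 ∧
    p 6 * v 6 + p 7 * v 7 + p 8 * v 8 = 0 ∧ p 9 * v 9 + p 10 * v 10 = 0 ∧
    p 11 * v 11 + p 12 * v 12 = 0 ∧ p 13 * v 13 + p 14 * v 14 = 0 ∧
    v 9 + v 0 - (-(1/2) * (v 11 + v 3) - (Real.sqrt 3 / 2) * v 4) = 0 ∧
    v 1 - ((Real.sqrt 3 / 2) * (v 11 + v 3) - (1/2) * v 4) = 0 ∧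
    v 10 + v 2 - (v 12 + v 5) = 0 ∧
    v 9 + v 0 - (-(1/2) * (v 13 + v 6) + (Real.sqrt 3 / 2) * v 7) = 0 ∧
    v 1 - (-(Real.sqrt 3 / 2) * (v 13 + v 6) - (1/2) * v 7) = 0 ∧
    v 10 + v 2 - (v 14 + v 8) = 0 := by
  obtain ⟨e0, e1, e2, e3, e4, e5, e6, e7, e8, e9, e10, e11⟩ := (deltaF_eq_zero_iff a b d p).1 hp
  have sphere (i j k : Fin 15) (r : ℝ) (hr : p i ^ 2 + p j ^ 2 + p k ^ 2 = r)
      (h : ∀ x, deltaF a b d x = 0 → x i ^ 2 + x j ^ 2 + x k ^ 2 = r) :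
      p i * v i + p j * v j + p k * v k = 0 := by
    have := eq_zero_of_mem_closure hv (h := fun t u => 2 * (p i * u i + p j * u j + p k * u k)
      + t * (u i ^ 2 + u j ^ 2 + u k ^ 2)) (by fun_prop) 1 fun t u hu => by
        have := h _ hu
        simp only [Pi.add_apply, Pi.smul_apply, smul_eq_mul] at this
        linear_combination this - hr
    linarith
  have circle (i j : Fin 15) (r : ℝ) (hr : p i ^ 2 + p j ^ 2 = r)
      (h : ∀ x, deltaF a b d x = 0 → x i ^ 2 + x j ^ 2 = r) : p i * v i + p j * v j = 0 := by
    have := eq_zero_of_mem_closure hv (h := fun t u => 2 * (p i * u i + p j * u j)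
      + t * (u i ^ 2 + u j ^ 2)) (by fun_prop) 1 fun t u hu => by
        have := h _ hu
        simp only [Pi.add_apply, Pi.smul_apply, smul_eq_mul] at this
        linear_combination this - hr
    linarith
  refine ⟨sphere 0 1 2 _ e0 fun x hx => ?_, sphere 3 4 5 _ e1 fun x hx => ?_,
    sphere 6 7 8 _ e2 fun x hx => ?_, circle 9 10 _ e3 fun x hx => ?_,
    circle 11 12 _ e4 fun x hx => ?_, circle 13 14 _ e5 fun x hx => ?_, ?_, ?_, ?_, ?_, ?_, ?_⟩
  iterate 6
    · rw [deltaF_eq_zero_iff] at hx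
      tauto
  · refine eq_zero_of_mem_closure hv (h := fun _ v => v 9 + v 0 - (-(1/2) * (v 11 + v 3)
      - (Real.sqrt 3 / 2) * v 4)) (by fun_prop) 1 fun t u hu => ?_
    obtain ⟨-, -, -, -, -, -, h, -⟩ := (deltaF_eq_zero_iff a b d _).1 hu
    simp only [Pi.add_apply, Pi.smul_apply, smul_eq_mul] at h
    linear_combination h - e6
  · refine eq_zero_of_mem_closure hv (h := fun _ v => v 1 - ((Real.sqrt 3 / 2) * (v 11 + v 3)
      - (1/2) * v 4)) (by fun_prop) 1 fun t u hu => ?_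
    obtain ⟨-, -, -, -, -, -, -, h, -⟩ := (deltaF_eq_zero_iff a b d _).1 hu
    simp only [Pi.add_apply, Pi.smul_apply, smul_eq_mul] at h
    linear_combination h - e7
  · refine eq_zero_of_mem_closure hv (h := fun _ v => v 10 + v 2 - (v 12 + v 5))
      (by fun_prop) 1 fun t u hu => ?_
    obtain ⟨-, -, -, -, -, -, -, -, h, -⟩ := (deltaF_eq_zero_iff a b d _).1 hu
    simp only [Pi.add_apply, Pi.smul_apply, smul_eq_mul] at h
    linear_combination h - e8
  · refine eq_zero_of_mem_closure hv (h := fun _ v => v 9 + v 0 - (-(1/2) * (v 13 + v 6)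
      + (Real.sqrt 3 / 2) * v 7)) (by fun_prop) 1 fun t u hu => ?_
    obtain ⟨-, -, -, -, -, -, -, -, -, h, -⟩ := (deltaF_eq_zero_iff a b d _).1 hu
    simp only [Pi.add_apply, Pi.smul_apply, smul_eq_mul] at h
    linear_combination h - e9
  · refine eq_zero_of_mem_closure hv (h := fun _ v => v 1 - (-(Real.sqrt 3 / 2) * (v 13 + v 6)
      - (1/2) * v 7)) (by fun_prop) 1 fun t u hu => ?_
    obtain ⟨-, -, -, -, -, -, -, -, -, -, h, -⟩ := (deltaF_eq_zero_iff a b d _).1 hu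
    simp only [Pi.add_apply, Pi.smul_apply, smul_eq_mul] at h
    linear_combination h - e10
  · refine eq_zero_of_mem_closure hv (h := fun _ v => v 10 + v 2 - (v 14 + v 8))
      (by fun_prop) 1 fun t u hu => ?_
    obtain ⟨-, -, -, -, -, -, -, -, -, -, -, h⟩ := (deltaF_eq_zero_iff a b d _).1 hu
    simp only [Pi.add_apply, Pi.smul_apply, smul_eq_mul] at h
    linear_combination h - e11

/-- The second-order condition coming from the linear dependency of the constraint differentials
of the first two legs at `q₄`. -/
theorem deltaF_quadratic {a b β d s : ℝ} {v : Fin 15 → ℝ}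
    (hp : deltaF a b d (deltaQ4Param β d s) = 0)
    (hv : ((0 : ℝ), v) ∈ closure {z : ℝ × (Fin 15 → ℝ) |
      z.1 ≠ 0 ∧ deltaQ4Param β d s + z.1 • z.2 ∈ {x | deltaF a b d x = 0}}) :
    v 0 ^ 2 + v 1 ^ 2 + v 2 ^ 2 - (v 3 ^ 2 + v 4 ^ 2 + v 5 ^ 2)
      + β * (v 9 ^ 2 + v 10 ^ 2 - (v 11 ^ 2 + v 12 ^ 2)) = 0 := by
  have h3 : Real.sqrt 3 ^ 2 = 3 := Real.sq_sqrt (by norm_num)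
  refine eq_zero_of_mem_closure hv (h := fun _ v => v 0 ^ 2 + v 1 ^ 2 + v 2 ^ 2
    - (v 3 ^ 2 + v 4 ^ 2 + v 5 ^ 2) + β * (v 9 ^ 2 + v 10 ^ 2 - (v 11 ^ 2 + v 12 ^ 2)))
    (by fun_prop) 2 fun t u hu => ?_
  obtain ⟨h0, h1, -, h3', h4, -, h6, h7, h8, -⟩ := (deltaF_eq_zero_iff a b d _).1 hu
  obtain ⟨e0, e1, -, e3, e4, -, e6, e7, -⟩ := (deltaF_eq_zero_iff a b d _).1 hp
  simp [deltaQ4Param] at h0 h1 h3' h4 h6 h7 h8 e0 e1 e3 e4 e6 e7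
  linear_combination h0 - h1 + β * (h3' - h4) - (e0 - e1 + β * (e3 - e4))
    + 2 * β * d * (h6 - e6) + 2 * β * d * Real.sqrt 3 * (h7 - e7) - 2 * β * s * h8
    + t * β * d * (u 11 + u 3) * h3

/-- Two linear functionals on displacements, on whose common kernel the quadratic form of
`deltaF_quadratic` is positive semidefinite. -/
noncomputable def legFunctionals (β d s : ℝ) : (Fin 15 → ℝ) →ₗ[ℝ] (Fin 2 → ℝ) where
  toFun v := ![s * (v 0 - 1/2 * v 3 - Real.sqrt 3 / 2 * v 4) + d * (v 2 + v 5),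
    s * (s / 2 * (v 0 - 1/2 * v 3 - Real.sqrt 3 / 2 * v 4)
      - Real.sqrt 3 / 2 * s * (v 1 + Real.sqrt 3 / 2 * v 3 - 1/2 * v 4) - d * (v 2 + v 5))
      + 2 * β * (s ^ 2 + d ^ 2) * v 11]
  map_add' v w := by ext i; fin_cases i <;> simp <;> ring
  map_smul' c v := by ext i; fin_cases i <;> simp <;> ring

set_option maxHeartbeats 800000 in
/-- A limit of difference quotients of the configuration space at `q₄` which is killed by
`legFunctionals` vanishes. -/
theorem eq_zero_of_tangent {a b β d s : ℝ} (hβ : 0 < β) (hd : 0 < d) (hs : 0 < s)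
    (hp : deltaF a b d (deltaQ4Param β d s) = 0) {v : Fin 15 → ℝ}
    (hv : ((0 : ℝ), v) ∈ closure {z : ℝ × (Fin 15 → ℝ) |
      z.1 ≠ 0 ∧ deltaQ4Param β d s + z.1 • z.2 ∈ {x | deltaF a b d x = 0}})
    (hker : legFunctionals β d s v = 0) : v = 0 := by
  have h3 : Real.sqrt 3 ^ 2 = 3 := Real.sq_sqrt (by norm_num)
  have hleg := deltaQ4Param_leg_three_ne_zero hβ hd hs
  have hQ := deltaF_quadratic hp hv
  obtain ⟨e0, -, e2, e3, e4, e5, e6, e7, e8, e9, e10, e11⟩ := deltaF_linearized hp hv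
  have k1 : s * (v 0 - 1/2 * v 3 - Real.sqrt 3 / 2 * v 4) + d * (v 2 + v 5) = 0 :=
    congrFun hker 0
  have k2 : s * (s / 2 * (v 0 - 1/2 * v 3 - Real.sqrt 3 / 2 * v 4)
      - Real.sqrt 3 / 2 * s * (v 1 + Real.sqrt 3 / 2 * v 3 - 1/2 * v 4) - d * (v 2 + v 5))
      + 2 * β * (s ^ 2 + d ^ 2) * v 11 = 0 := congrFun hker 1
  have p7 : deltaQ4Param β d s 7 = 0 := rfl
  rw [p7] at e2
  generalize deltaQ4Param β d s 6 = p6 at *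
  generalize deltaQ4Param β d s 8 = p8 at *
  generalize deltaQ4Param β d s 13 = p13 at *
  generalize deltaQ4Param β d s 14 = p14 at *
  replace e0 : d * v 0 + Real.sqrt 3 * d * v 1 - s * v 2 = 0 := by
    simp [deltaQ4Param] at e0
    refine (mul_eq_zero.1 ?_).resolve_left hβ.ne'
    linear_combination -e0
  replace e3 : -d * v 9 + s * v 10 = 0 := e3
  replace e4 : -d * v 11 + s * v 12 = 0 := e4
  obtain ⟨t, ht⟩ : ∃ t, v 9 = s * t := ⟨v 9 / s, by field_simp⟩
  obtain ⟨r, hr⟩ : ∃ r, v 11 = s * r := ⟨v 11 / s, by field_simp⟩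
  have h10 : v 10 = d * t := mul_left_cancel₀ hs.ne' (by linear_combination e3 + d * ht)
  have h12 : v 12 = d * r := mul_left_cancel₀ hs.ne' (by linear_combination e4 + d * hr)
  rw [ht, h10, hr, h12] at hQ
  rw [ht, hr] at e6
  rw [hr] at e7 k2
  rw [h10, h12] at e8
  rw [ht] at e9
  rw [h10] at e11
  replace k2 : s / 2 * (v 0 - 1/2 * v 3 - Real.sqrt 3 / 2 * v 4)
      - Real.sqrt 3 / 2 * s * (v 1 + Real.sqrt 3 / 2 * v 3 - 1/2 * v 4) - d * (v 2 + v 5)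
      + 2 * β * (s ^ 2 + d ^ 2) * r = 0 :=
    (mul_eq_zero.1 (by linear_combination k2)).resolve_left hs.ne'
  have hsum : β * (s ^ 2 + d ^ 2) * (t ^ 2 + r ^ 2) = 0 := by
    linear_combination hQ - (v 0 - 1/2 * v 3 - Real.sqrt 3 / 2 * v 4) * e6
      - (v 1 + Real.sqrt 3 / 2 * v 3 - 1/2 * v 4) * e7 - (v 2 + v 5) * e8 + t * k1 + r * k2
      - 1/4 * (v 3 ^ 2 + v 4 ^ 2) * h3
  have htr : t ^ 2 + r ^ 2 = 0 := (mul_eq_zero.1 hsum).resolve_left (by positivity)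
  obtain rfl : t = 0 := by nlinarith [sq_nonneg t, sq_nonneg r]
  obtain rfl : r = 0 := by simpa using htr
  have h2 : s * v 0 + d * v 2 = 0 := by linear_combination k1 / 2 + s / 2 * e6 + d / 2 * e8
  have h1 : v 0 - Real.sqrt 3 / 2 * v 1 + v 0 / 2 = 0 := by
    refine ((mul_eq_zero (a := s)).1 ?_).resolve_left hs.ne'
    linear_combination h2 + k2 / 2 + s / 4 * e6 - Real.sqrt 3 * s / 4 * e7 - d / 2 * e8
  have h1' : v 1 = Real.sqrt 3 * v 0 := by
    linear_combination -(2 * Real.sqrt 3 / 3) * h1 - v 1 / 3 * h3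
  have hv0 : v 0 = 0 := by
    refine ((mul_eq_zero (a := 4 * d ^ 2 + s ^ 2)).1 ?_).resolve_left (by positivity)
    linear_combination d * e0 + s * h2 - Real.sqrt 3 * d ^ 2 * h1' - d ^ 2 * v 0 * h3
  have hv1 : v 1 = 0 := by simpa [hv0] using h1'
  have hv2 : v 2 = 0 := mul_left_cancel₀ hd.ne' (by linear_combination h2 - s * hv0)
  have hv3 : v 3 = 0 := by
    linear_combination e6 / 2 - Real.sqrt 3 / 2 * e7 - hv0 / 2 + Real.sqrt 3 / 2 * hv1
      - v 3 / 4 * h3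
  have hv4 : v 4 = 0 := by linear_combination 2 * e7 - 2 * hv1 + Real.sqrt 3 * hv3
  have hv5 : v 5 = 0 := by linear_combination hv2 - e8
  have h13 : v 13 + v 6 = 0 := by
    linear_combination e9 / 2 + Real.sqrt 3 / 2 * e10 - hv0 / 2 - Real.sqrt 3 / 2 * hv1
      - (v 13 + v 6) / 4 * h3
  have hv7 : v 7 = 0 := by linear_combination 2 * e10 - 2 * hv1 - Real.sqrt 3 * h13
  have h14 : v 14 + v 8 = 0 := by linear_combination hv2 - e11
  have hv6 : v 6 = 0 := by
    refine (mul_eq_zero.1 ?_).resolve_left hleg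
    linear_combination p14 * e2 + p8 * e5 - p8 * p13 * h13 - p8 * p14 * h14
  have hv8 : v 8 = 0 := by
    refine (mul_eq_zero.1 ?_).resolve_left hleg
    linear_combination -p13 * e2 - p6 * e5 + p6 * p13 * h13 + p6 * p14 * h14
  have hv13 : v 13 = 0 := by linear_combination h13 - hv6
  have hv14 : v 14 = 0 := by linear_combination h14 - hv8
  ext i
  fin_cases i
  exacts [hv0, hv1, hv2, hv3, hv4, hv5, hv6, hv7, hv8, ht.trans (mul_zero s),
    h10.trans (mul_zero d), hr.trans (mul_zero s), h12.trans (mul_zero d), hv13, hv14]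

/-- `q₄` is not a manifold point of the configuration space: no neighborhood of `q₄`
intersects `X_{a,b,d}` in a 3-dimensional `C¹` embedded submanifold of `ℝ¹⁵`. -/
theorem deltaQ4_not_manifold_point (a b d : ℝ) (had : a > d) (hd : d > 0) (hb : b > 0)
    (hbne : b ≠ (3 * d ^ 2 - a ^ 2) / Real.sqrt (a ^ 2 + 3 * d ^ 2)) :
    ∀ U : Set (Fin 15 → ℝ), IsOpen U → deltaQ4 a b d ∈ U →
      ¬ IsC1Submanifold 3 (U ∩ {x | deltaF a b d x = 0}) := by
  intro U _ hqU hM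
  obtain ⟨β, s, hβ, hs, ha2, hb2, hq⟩ := exists_deltaQ4_eq_deltaQ4Param had hd hb
  rw [hq] at hqU
  have hp := deltaF_deltaQ4Param hβ hs ha2 hb2
  obtain ⟨L, hL, hcl⟩ := hM.exists_injective_tangent (by norm_num) ⟨hqU, hp⟩
  obtain ⟨y, hy, hy0⟩ := Submodule.exists_mem_ne_zero_of_ne_bot
    (LinearMap.ker_ne_bot_of_finrank_lt (f := legFunctionals β d s ∘ₗ L) (by simp))
  refine hy0 (hL ?_)
  have hv := closure_mono (fun z (hz : _ ∧ _ ∈ U ∩ _) => And.intro hz.1 hz.2.2) (hcl y)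
  rw [map_zero]
  exact eq_zero_of_tangent hβ hd hs hp hv hy
end

section
/- For all p ∈ ℝ³ and all ψ₁, ψ₂, ψ₃ ∈ ℝ, the point Q(p, ψ₁, ψ₂, ψ₃) lies in the transformed configuration space X̃_{a,b,d} if and only if |p − m₃(ψ₁)|² = b², |p − m₁(ψ₂)|² = b² and |p − m₂(ψ₃)|² = b². -/
/-- The constraint map of the transformed configuration space `X̃_{a,b,d}`. -/
noncomputable def deltaFt (a b d : ℝ) (x : Fin 15 → ℝ) : Fin 12 → ℝ :=
  ![ x 0 ^ 2 + x 1 ^ 2 + x 2 ^ 2 - b ^ 2,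
     x 3 ^ 2 + x 4 ^ 2 + x 5 ^ 2 - b ^ 2,
     x 6 ^ 2 + x 7 ^ 2 + x 8 ^ 2 - b ^ 2,
     x 9 ^ 2 + x 10 ^ 2 - a ^ 2,
     x 11 ^ 2 + x 12 ^ 2 - a ^ 2,
     x 13 ^ 2 + x 14 ^ 2 - a ^ 2,
     -- l̃₁,l̃₂,l̃₃ : (d+ca₁+x₁, y₁, sa₁+z₁) − A·(d+ca₂, 0, sa₂) − (x₂,y₂,z₂)
     (d + x 9 + x 0) - (-(1/2) * (d + x 11)) - x 3,
     x 1 - (Real.sqrt 3 / 2) * (d + x 11) - x 4,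
     (x 10 + x 2) - x 12 - x 5,
     -- l̃₄,l̃₅,l̃₆ : (d+ca₁+x₁, y₁, sa₁+z₁) − A⁻¹·(d+ca₃, 0, sa₃) − (x₃,y₃,z₃)
     (d + x 9 + x 0) - (-(1/2) * (d + x 13)) - x 6,
     x 1 - (-(Real.sqrt 3 / 2) * (d + x 13)) - x 7,
     (x 10 + x 2) - x 14 - x 8 ]

/-- `m₃(ψ) = (d + a cos ψ, 0, a sin ψ)`. -/
noncomputable def deltaM3 (a d ψ : ℝ) : Fin 3 → ℝ := ![d + a * Real.cos ψ, 0, a * Real.sin ψ]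

/-- `m₁(ψ) = A·m₃(ψ)`, with `A` the rotation by 120° about the z-axis. -/
noncomputable def deltaM1 (a d ψ : ℝ) : Fin 3 → ℝ :=
  ![-(1/2) * (d + a * Real.cos ψ), (Real.sqrt 3 / 2) * (d + a * Real.cos ψ), a * Real.sin ψ]

/-- `m₂(ψ) = A⁻¹·m₃(ψ)`. -/
noncomputable def deltaM2 (a d ψ : ℝ) : Fin 3 → ℝ :=
  ![-(1/2) * (d + a * Real.cos ψ), -(Real.sqrt 3 / 2) * (d + a * Real.cos ψ), a * Real.sin ψ]

/-- The parametrization `Q(p, ψ₁, ψ₂, ψ₃)` of candidate configurations. -/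
noncomputable def deltaQpt (a d : ℝ) (p : Fin 3 → ℝ) (ψ₁ ψ₂ ψ₃ : ℝ) : Fin 15 → ℝ :=
  ![ p 0 - deltaM3 a d ψ₁ 0, p 1 - deltaM3 a d ψ₁ 1, p 2 - deltaM3 a d ψ₁ 2,
     p 0 - deltaM1 a d ψ₂ 0, p 1 - deltaM1 a d ψ₂ 1, p 2 - deltaM1 a d ψ₂ 2,
     p 0 - deltaM2 a d ψ₃ 0, p 1 - deltaM2 a d ψ₃ 1, p 2 - deltaM2 a d ψ₃ 2,
     a * Real.cos ψ₁, a * Real.sin ψ₁,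
     a * Real.cos ψ₂, a * Real.sin ψ₂,
     a * Real.cos ψ₃, a * Real.sin ψ₃ ]

/-- Characterization of points of the transformed configuration space:
`Q(p,ψ₁,ψ₂,ψ₃) ∈ X̃_{a,b,d}` iff `p` has distance `b` from each of
`m₃(ψ₁)`, `m₁(ψ₂)`, `m₂(ψ₃)`. -/
theorem deltaQpt_mem_iff (a b d : ℝ) (p : Fin 3 → ℝ) (ψ₁ ψ₂ ψ₃ : ℝ) :
    deltaFt a b d (deltaQpt a d p ψ₁ ψ₂ ψ₃) = 0 ↔
      ((p 0 - deltaM3 a d ψ₁ 0) ^ 2 + (p 1 - deltaM3 a d ψ₁ 1) ^ 2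
          + (p 2 - deltaM3 a d ψ₁ 2) ^ 2 = b ^ 2 ∧
       (p 0 - deltaM1 a d ψ₂ 0) ^ 2 + (p 1 - deltaM1 a d ψ₂ 1) ^ 2
          + (p 2 - deltaM1 a d ψ₂ 2) ^ 2 = b ^ 2 ∧
       (p 0 - deltaM2 a d ψ₃ 0) ^ 2 + (p 1 - deltaM2 a d ψ₃ 1) ^ 2
          + (p 2 - deltaM2 a d ψ₃ 2) ^ 2 = b ^ 2) := by
  constructor
  · intro h
    exact ⟨sub_eq_zero.mp (congrFun h 0), sub_eq_zero.mp (congrFun h 1),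
      sub_eq_zero.mp (congrFun h 2)⟩
  · rintro ⟨h₁, h₂, h₃⟩
    have circle (ψ : ℝ) : (a * Real.cos ψ) ^ 2 + (a * Real.sin ψ) ^ 2 - a ^ 2 = 0 := by
      linear_combination a ^ 2 * Real.cos_sq_add_sin_sq ψ
    funext i
    fin_cases i
    · exact sub_eq_zero.mpr h₁
    · exact sub_eq_zero.mpr h₂
    · exact sub_eq_zero.mpr h₃
    · exact circle ψ₁
    · exact circle ψ₂
    · exact circle ψ₃
    all_goals
      simp [deltaFt, deltaQpt, deltaM1, deltaM2, deltaM3]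
      try ring
end

section
/- Let r, p_x, p_y : ℝ → ℝ be real-analytic on a neighborhood of 0, with r(0) = r₀ > 0, r'(0) = 0, (p_x(0), p_y(0)) = (0,0) and (p_x'(0), p_y'(0)) ≠ (0,0). Then there exist ε > 0 and two real-analytic paths γ₊, γ₋ : (−ε, ε) → ℝ² such that, writing γ±(t) = (x(t), y(t)), for every t ∈ (−ε, ε) one has x(t)² + y(t)² − r₀² = 0 and (x(t) − p_x(t))² + (y(t) − p_y(t))² − r(t)² = 0, and moreover γ±(0) = ±(r₀/√(p_x'(0)² + p_y'(0)²))·(−p_y'(0), p_x'(0)). -/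
open Filter Topology

theorem AnalyticAt.dslope_same {𝕜 E : Type*} [NontriviallyNormedField 𝕜] [NormedAddCommGroup E]
    [NormedSpace 𝕜 E] {f : 𝕜 → E} {a : 𝕜} (hf : AnalyticAt 𝕜 f a) :
    AnalyticAt 𝕜 (dslope f a) a :=
  let ⟨_, hp⟩ := hf
  hp.has_fpower_series_dslope_fslope.analyticAt

theorem AnalyticAt.real_sqrt_s12 {E : Type*} [NormedAddCommGroup E] [NormedSpace ℝ E]
    {f : E → ℝ} {x : E} (hf : AnalyticAt ℝ f x) (hx : 0 < f x) :
    AnalyticAt ℝ (fun y => √(f y)) x :=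
  (Real.contDiffAt_sqrt hx.ne').analyticAt.comp hf

/-- The point on the line `u * x + v * y = c` at signed distance `s / √(u ^ 2 + v ^ 2)` from the
foot of the perpendicular through the origin. -/
noncomputable def pointOnLine (u v c s : ℝ) : ℝ × ℝ :=
  ((c * u - s * v) / (u ^ 2 + v ^ 2), (c * v + s * u) / (u ^ 2 + v ^ 2))

theorem pointOnLine_mem_line {u v : ℝ} (h : u ^ 2 + v ^ 2 ≠ 0) (c s : ℝ) :
    u * (pointOnLine u v c s).1 + v * (pointOnLine u v c s).2 = c := by
  simp only [pointOnLine]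
  field_simp
  ring

theorem pointOnLine_mem_circle {u v c s ρ : ℝ} (h : u ^ 2 + v ^ 2 ≠ 0)
    (hs : s ^ 2 = ρ ^ 2 * (u ^ 2 + v ^ 2) - c ^ 2) :
    (pointOnLine u v c s).1 ^ 2 + (pointOnLine u v c s).2 ^ 2 = ρ ^ 2 := by
  simp only [pointOnLine]
  field_simp
  linear_combination (u ^ 2 + v ^ 2) * hs

theorem AnalyticAt.pointOnLine {E : Type*} [NormedAddCommGroup E] [NormedSpace ℝ E]
    {u v c s : E → ℝ} {x : E} (hu : AnalyticAt ℝ u x) (hv : AnalyticAt ℝ v x)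
    (hc : AnalyticAt ℝ c x) (hs : AnalyticAt ℝ s x) (h : u x ^ 2 + v x ^ 2 ≠ 0) :
    AnalyticAt ℝ (fun y => pointOnLine (u y) (v y) (c y) (s y)) x :=
  (((hc.mul hu).sub (hs.mul hv)).div ((hu.pow 2).add (hv.pow 2)) h).prod
    (((hc.mul hv).add (hs.mul hu)).div ((hu.pow 2).add (hv.pow 2)) h)

theorem pointOnLine_zero_mul_sqrt {u v : ℝ} (h : 0 < u ^ 2 + v ^ 2) (ρ : ℝ) :
    pointOnLine u v 0 (ρ * √(u ^ 2 + v ^ 2)) = (ρ / √(u ^ 2 + v ^ 2)) • (-v, u) := by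
  have hn : √(u ^ 2 + v ^ 2) ≠ 0 := (Real.sqrt_pos.2 h).ne'
  have hd : ρ * √(u ^ 2 + v ^ 2) / (u ^ 2 + v ^ 2) = ρ / √(u ^ 2 + v ^ 2) := by
    rw [div_eq_div_iff h.ne' hn, mul_assoc, Real.mul_self_sqrt h.le]
  simp only [pointOnLine, Prod.smul_mk, smul_eq_mul, ← hd]
  ext <;> ring



/-- Analytic intersection of a fixed circle with an analytically moving circle that
degenerates to the fixed one at `t = 0` (Lemma about circle intersections). -/
theorem circle_intersection_analytic_paths (r px py : ℝ → ℝ) (r₀ : ℝ)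
    (hana : ∃ ε₀ > (0 : ℝ), ∀ t ∈ Set.Ioo (-ε₀) ε₀,
      AnalyticAt ℝ r t ∧ AnalyticAt ℝ px t ∧ AnalyticAt ℝ py t)
    (hr0 : r 0 = r₀) (hr0pos : r₀ > 0) (hr' : deriv r 0 = 0)
    (hp0 : px 0 = 0 ∧ py 0 = 0) (hp' : (deriv px 0, deriv py 0) ≠ (0, 0)) :
    ∃ ε > (0 : ℝ), ∃ γp γm : ℝ → ℝ × ℝ,
      (∀ t ∈ Set.Ioo (-ε) ε,
        AnalyticAt ℝ γp t ∧ AnalyticAt ℝ γm t ∧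
        ((γp t).1 ^ 2 + (γp t).2 ^ 2 - r₀ ^ 2 = 0 ∧
          ((γp t).1 - px t) ^ 2 + ((γp t).2 - py t) ^ 2 - r t ^ 2 = 0) ∧
        ((γm t).1 ^ 2 + (γm t).2 ^ 2 - r₀ ^ 2 = 0 ∧
          ((γm t).1 - px t) ^ 2 + ((γm t).2 - py t) ^ 2 - r t ^ 2 = 0)) ∧
      γp 0 = (r₀ / Real.sqrt (deriv px 0 ^ 2 + deriv py 0 ^ 2))
          • (-(deriv py 0), deriv px 0) ∧
      γm 0 = -((r₀ / Real.sqrt (deriv px 0 ^ 2 + deriv py 0 ^ 2))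
          • (-(deriv py 0), deriv px 0)) := by
  obtain ⟨ε₀, hε₀, hana⟩ := hana
  obtain ⟨har, hax, hay⟩ := hana 0 ⟨by linarith, hε₀⟩
  obtain ⟨hx0, hy0⟩ := hp0
  set u := dslope px 0
  set v := dslope py 0
  set w := dslope (fun t => r t ^ 2) 0
  have hu0 : u 0 = deriv px 0 := dslope_same _ _
  have hv0 : v 0 = deriv py 0 := dslope_same _ _
  have hw0 : w 0 = 0 := by
    have := (har.differentiableAt.hasDerivAt.pow 2).deriv
    rw [hr', mul_zero] at this
    exact (dslope_same _ _).trans this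
  have hux (t : ℝ) : t * u t = px t := by simpa [hx0] using sub_smul_dslope px 0 t
  have hvy (t : ℝ) : t * v t = py t := by simpa [hy0] using sub_smul_dslope py 0 t
  have hwr (t : ℝ) : t * w t = r t ^ 2 - r₀ ^ 2 := by
    simpa [hr0] using sub_smul_dslope (fun t => r t ^ 2) 0 t
  have hau : AnalyticAt ℝ u 0 := hax.dslope_same
  have hav : AnalyticAt ℝ v 0 := hay.dslope_same
  have haw : AnalyticAt ℝ w 0 := (har.pow 2).dslope_same
  set c : ℝ → ℝ := fun t => (t * (u t ^ 2 + v t ^ 2) - w t) / 2 with hc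
  have hc0 : c 0 = 0 := by simp [hc, hw0]
  have hac : AnalyticAt ℝ c 0 :=
    ((analyticAt_id.mul ((hau.pow 2).add (hav.pow 2))).sub haw).div_const
  have hS0 : 0 < u 0 ^ 2 + v 0 ^ 2 := by
    by_contra! h
    refine hp' ?_
    rw [← hu0, ← hv0, Prod.mk.injEq]
    constructor <;> nlinarith [sq_nonneg (u 0), sq_nonneg (v 0)]
  set D : ℝ → ℝ := fun t => r₀ ^ 2 * (u t ^ 2 + v t ^ 2) - c t ^ 2 with hD
  have haD : AnalyticAt ℝ D 0 :=
    (analyticAt_const.mul ((hau.pow 2).add (hav.pow 2))).sub (hac.pow 2)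
  have hD0 : 0 < D 0 := by
    simp only [hD, hc0]
    have := mul_pos (pow_pos hr0pos 2) hS0
    linarith
  have has : AnalyticAt ℝ (fun t => √(D t)) 0 := haD.real_sqrt_s12 hD0
  have hs0 : √(D 0) = r₀ * √(u 0 ^ 2 + v 0 ^ 2) := by
    simp [hD, hc0, Real.sqrt_mul (sq_nonneg r₀), Real.sqrt_sq hr0pos.le]
  have hap := hau.pointOnLine hav hac has hS0.ne'
  have ham := hau.pointOnLine hav hac has.neg hS0.ne'
  have hev : ∀ᶠ t in 𝓝 (0 : ℝ), 0 < u t ^ 2 + v t ^ 2 ∧ 0 < D t ∧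
      AnalyticAt ℝ (fun t => pointOnLine (u t) (v t) (c t) (√(D t))) t ∧
      AnalyticAt ℝ (fun t => pointOnLine (u t) (v t) (c t) (-√(D t))) t :=
    (((hau.pow 2).add (hav.pow 2)).continuousAt.eventually (lt_mem_nhds hS0)).and <|
      (haD.continuousAt.eventually (lt_mem_nhds hD0)).and <|
        hap.eventually_analyticAt.and ham.eventually_analyticAt
  obtain ⟨ε, hε, hball⟩ := Metric.eventually_nhds_iff_ball.1 hev
  have hsol (t s : ℝ) (hS : 0 < u t ^ 2 + v t ^ 2) (hs : s ^ 2 = D t) :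
      (pointOnLine (u t) (v t) (c t) s).1 ^ 2 + (pointOnLine (u t) (v t) (c t) s).2 ^ 2
          - r₀ ^ 2 = 0 ∧
        ((pointOnLine (u t) (v t) (c t) s).1 - px t) ^ 2
          + ((pointOnLine (u t) (v t) (c t) s).2 - py t) ^ 2 - r t ^ 2 = 0 := by
    have hcirc := pointOnLine_mem_circle hS.ne' hs
    have hline := pointOnLine_mem_line hS.ne' (c t) s
    have hct : c t = (t * (u t ^ 2 + v t ^ 2) - w t) / 2 := rfl
    refine ⟨sub_eq_zero.2 hcirc, ?_⟩
    rw [← hux, ← hvy]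
    linear_combination hcirc - 2 * t * hline - 2 * t * hct + hwr t
  refine ⟨ε, hε, fun t => pointOnLine (u t) (v t) (c t) (√(D t)),
    fun t => pointOnLine (u t) (v t) (c t) (-√(D t)), fun t ht => ?_, ?_, ?_⟩
  · obtain ⟨hS, hDt, hp, hm⟩ := hball t (by rwa [Real.ball_eq_Ioo, zero_sub, zero_add])
    exact ⟨hp, hm, hsol t _ hS (Real.sq_sqrt hDt.le),
      hsol t _ hS (by rw [neg_sq, Real.sq_sqrt hDt.le])⟩
  · simp only [hc0, hs0, pointOnLine_zero_mul_sqrt hS0, ← hu0, ← hv0]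
  · simp only [hc0, hs0, ← neg_mul, pointOnLine_zero_mul_sqrt hS0, ← hu0, ← hv0, neg_div, neg_smul]
end

section
/- Let X = {(x,y) ∈ ℝ² : y³ + x²y − x⁴ = 0}. Then the origin is a manifold point of X: there exist ε > 0 and a real-analytic function h : (−ε, ε) → ℝ with h(0) = 0 such that for all (x,y) ∈ ℝ² with x² + y² < ε², one has y³ + x²y − x⁴ = 0 if and only if y = h(x). In other words, near the origin X is the graph of an analytic function, even though the origin is a singular point of X in the algebraic sense (the gradient of y³ + x²y − x⁴ vanishes there). -/
open Filter Topology

/-- For each `x` the equation `y³ + x²y = x⁴` has at most one solution `y`. -/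
lemma cusp_curve_unique {x y z : ℝ} (hy : y ^ 3 + x ^ 2 * y - x ^ 4 = 0)
    (hz : z ^ 3 + x ^ 2 * z - x ^ 4 = 0) : y = z := by
  have hmul : (y - z) * (y ^ 2 + y * z + z ^ 2 + x ^ 2) = 0 := by linear_combination hy - hz
  rcases mul_eq_zero.mp hmul with h | h
  · exact sub_eq_zero.mp h
  · have hy0 : y = 0 := by
      nlinarith [sq_nonneg (y + z), sq_nonneg x, sq_nonneg y, sq_nonneg z]
    have hz0 : z = 0 := by
      nlinarith [sq_nonneg (y + z), sq_nonneg x, sq_nonneg y, sq_nonneg z]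
    rw [hy0, hz0]

/-- The equation `s u³ + u = 1` has a solution `u` depending analytically on `s` near `0`. -/
lemma exists_analyticAt_cubic_root :
    ∃ φ : ℝ → ℝ, AnalyticAt ℝ φ 0 ∧ ∀ᶠ s in 𝓝 0, s * φ s ^ 3 + φ s = 1 := by
  let g : ℝ → ℝ := fun u => (1 - u) / u ^ 3
  have hg : AnalyticAt ℝ g 1 := by
    refine AnalyticAt.div ?_ ?_ (by norm_num) <;> fun_prop
  have hg1 : g 1 = 0 := by simp [g]
  have hd : HasDerivAt g (-1) 1 := by
    convert! ((hasDerivAt_id (1 : ℝ)).const_sub 1).div (hasDerivAt_pow 3 (1 : ℝ)) (by norm_num)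
      using 1
    norm_num
  have hg' : deriv g 1 ≠ 0 := by rw [hd.deriv]; norm_num
  have hφ := hg.analyticAt_localInverse hg'
  have hinv := hg.hasStrictDerivAt.eventually_right_inverse hg'
  have hone := (hg.hasStrictDerivAt.eventually_left_inverse hg').self_of_nhds
  set φ := hg.hasStrictDerivAt.localInverse _ _ _ hg'
  rw [hg1] at hφ hinv hone
  refine ⟨φ, hφ, ?_⟩
  have hne : ∀ᶠ s in 𝓝 0, φ s ≠ 0 :=
    hφ.continuousAt.eventually_ne (by rw [hone]; exact one_ne_zero)
  filter_upwards [hinv, hne] with s hs hs0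
  have h := (div_eq_iff (pow_ne_zero 3 hs0)).mp hs
  linear_combination -h

/-- The origin is a manifold point of the curve `y³ + x²y − x⁴ = 0`: near the origin the
curve is the graph of a real-analytic function, even though the gradient of the defining
polynomial vanishes at the origin. -/
theorem origin_manifold_point_of_cusp_curve :
    (∃ ε > (0 : ℝ), ∃ h : ℝ → ℝ,
      (∀ x ∈ Set.Ioo (-ε) ε, AnalyticAt ℝ h x) ∧ h 0 = 0 ∧
      ∀ x y : ℝ, x ^ 2 + y ^ 2 < ε ^ 2 →
        (y ^ 3 + x ^ 2 * y - x ^ 4 = 0 ↔ y = h x)) ∧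
    fderiv ℝ (fun p : ℝ × ℝ => p.2 ^ 3 + p.1 ^ 2 * p.2 - p.1 ^ 4) (0, 0) = 0 := by
  constructor
  · obtain ⟨φ, hφ, hroot⟩ := exists_analyticAt_cubic_root
    have hsq : Tendsto (fun x : ℝ => x ^ 2) (𝓝 0) (𝓝 0) :=
      Continuous.tendsto' (by fun_prop) _ _ (by norm_num)
    obtain ⟨ε, hε, hball⟩ := Metric.eventually_nhds_iff.mp
      (hsq.eventually (hφ.eventually_analyticAt.and hroot))
    refine ⟨ε, hε, fun x => x ^ 2 * φ (x ^ 2), ?_, by simp, ?_⟩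
    · intro x hx
      have hφx := (hball (y := x) (by rw [Real.dist_0_eq_abs]; exact abs_lt.mpr hx)).1
      have hpow : AnalyticAt ℝ (fun x : ℝ => x ^ 2) x := by fun_prop
      exact hpow.mul (AnalyticAt.fun_comp hφx hpow)
    · intro x y hxy
      have hx : |x| < ε := abs_lt_of_sq_lt_sq (by nlinarith [sq_nonneg y]) hε.le
      have hu := (hball (y := x) (by rwa [Real.dist_0_eq_abs])).2
      have hcurve : (x ^ 2 * φ (x ^ 2)) ^ 3 + x ^ 2 * (x ^ 2 * φ (x ^ 2)) - x ^ 4 = 0 := by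
        linear_combination x ^ 4 * hu
      exact ⟨fun hy => cusp_curve_unique hy hcurve, fun hy => hy ▸ hcurve⟩
  · have h1 := hasFDerivAt_fst (𝕜 := ℝ) (p := ((0, 0) : ℝ × ℝ))
    have h2 := hasFDerivAt_snd (𝕜 := ℝ) (p := ((0, 0) : ℝ × ℝ))
    refine HasFDerivAt.fderiv ?_
    convert! ((h2.pow 3).add ((h1.pow 2).mul h2)).sub (h1.pow 4) using 1
    simp
end

section
/- Let l > 0 and let X = {(x_B, y_B, x_C) ∈ ℝ³ : x_B² + y_B² − l² = 0 and (x_C − x_B)² + y_B² − l² = 0} be the configuration space of the crank-slider mechanism with equal link lengths l₁ = l₂ = l. Then the point (0, l, 0) is not a manifold point of X: for every open neighborhood U of (0, l, 0) in ℝ³, the set U ∩ X is not a 1-dimensional C¹ embedded submanifold of ℝ³. (Indeed X contains the two analytic curves t ↦ (l cos t, l sin t, 2l cos t) and t ↦ (l cos t, l sin t, 0), which pass through (0, l, 0) with linearly independent tangent vectors.) -/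
/-- At each point of a `C¹` submanifold there is an injective linear map sending the velocity of
every curve in the submanifold through that point into the coordinate subspace. -/
theorem IsC1Submanifold.exists_injective_velocity {n k : ℕ} {S : Set (Fin n → ℝ)}
    (hS : IsC1Submanifold k S) {p : Fin n → ℝ} (hp : p ∈ S) :
    ∃ A : (Fin n → ℝ) →L[ℝ] (Fin n → ℝ), Function.Injective A ∧
      ∀ (γ : ℝ → Fin n → ℝ) (v : Fin n → ℝ) (t₀ : ℝ), HasDerivAt γ v t₀ → γ t₀ = p →
        (∀ᶠ t in nhds t₀, γ t ∈ S) → ∀ i : Fin n, k ≤ (i : ℕ) → A v i = 0 := by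
  obtain ⟨U, W, Φ, Ψ, hU, hpU, hW, hΦ, hΨ, hΦm, -, hΨΦ, -, himg⟩ := hS p hp
  have hdΦ : HasFDerivAt Φ (fderiv ℝ Φ p) p :=
    ((hΦ.contDiffAt (hU.mem_nhds hpU)).differentiableAt one_ne_zero).hasFDerivAt
  have hdΨ : HasFDerivAt Ψ (fderiv ℝ Ψ (Φ p)) (Φ p) :=
    ((hΨ.contDiffAt (hW.mem_nhds (hΦm hpU))).differentiableAt one_ne_zero).hasFDerivAt
  have hid : HasFDerivAt (Ψ ∘ Φ) (ContinuousLinearMap.id ℝ (Fin n → ℝ)) p :=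
    (hasFDerivAt_id p).congr_of_eventuallyEq
      (Filter.eventually_of_mem (hU.mem_nhds hpU) hΨΦ)
  have hcomp := (hdΨ.comp p hdΦ).unique hid
  refine ⟨fderiv ℝ Φ p, ?_, ?_⟩
  · exact Function.LeftInverse.injective (g := fderiv ℝ Ψ (Φ p))
      fun x => DFunLike.congr_fun hcomp x
  · intro γ v t₀ hγ hγp hγS i hi
    subst hγp
    have hd : HasDerivAt (fun t => Φ (γ t) i) (fderiv ℝ Φ (γ t₀) v i) t₀ :=
      hasDerivAt_pi.1 (hdΦ.comp_hasDerivAt t₀ hγ) i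
    have hzero : (fun t => Φ (γ t) i) =ᶠ[nhds t₀] fun _ => 0 := by
      filter_upwards [hγS, hγ.continuousAt.eventually_mem (hU.mem_nhds hpU)] with t hS hU
      have hmem : Φ (γ t) ∈ Φ '' (S ∩ U) := ⟨γ t, ⟨hS, hU⟩, rfl⟩
      rw [himg] at hmem
      exact hmem.2 i hi
    exact hd.unique ((hasDerivAt_const t₀ (0 : ℝ)).congr_of_eventuallyEq hzero)

/-- The circle of radius `l` in the first two coordinates, with third coordinate `c cos t`, has
velocity `(-l, 0, -c)` at `t = π / 2`. -/
theorem hasDerivAt_circle_lift (l c : ℝ) :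
    HasDerivAt (fun t : ℝ => (![l * Real.cos t, l * Real.sin t, c * Real.cos t] : Fin 3 → ℝ))
      ![-l, 0, -c] (Real.pi / 2) := by
  rw [hasDerivAt_pi]
  intro i
  fin_cases i
  · simpa using (Real.hasDerivAt_cos (Real.pi / 2)).const_mul l
  · simpa using (Real.hasDerivAt_sin (Real.pi / 2)).const_mul l
  · simpa using (Real.hasDerivAt_cos (Real.pi / 2)).const_mul c

/-- For the crank-slider with equal link lengths `l₁ = l₂ = l`, the point `(0, l, 0)` is
not a manifold point of the configuration space: no neighborhood of it intersects the
configuration space in a 1-dimensional `C¹` embedded submanifold of `ℝ³`. -/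
theorem crank_slider_equal_lengths_singular (l : ℝ) (hl : l > 0) :
    ∀ U : Set (Fin 3 → ℝ), IsOpen U → (![0, l, 0] : Fin 3 → ℝ) ∈ U →
      ¬ IsC1Submanifold 1
        (U ∩ {p : Fin 3 → ℝ | p 0 ^ 2 + p 1 ^ 2 - l ^ 2 = 0 ∧
          (p 2 - p 0) ^ 2 + p 1 ^ 2 - l ^ 2 = 0}) := by
  intro U hU hpU hS
  obtain ⟨A, hA, hvel⟩ := hS.exists_injective_velocity (p := ![0, l, 0]) ⟨hpU, by simp⟩
  have tangent : ∀ c : ℝ, (∀ t : ℝ, (c * Real.cos t - l * Real.cos t) ^ 2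
      = (l * Real.cos t) ^ 2) → ∀ i : Fin 3, 1 ≤ (i : ℕ) → A ![-l, 0, -c] i = 0 := by
    intro c hc
    have hd := hasDerivAt_circle_lift l c
    have hstart : (![l * Real.cos (Real.pi / 2), l * Real.sin (Real.pi / 2),
        c * Real.cos (Real.pi / 2)] : Fin 3 → ℝ) = ![0, l, 0] := by simp
    refine hvel _ _ _ hd hstart ?_
    filter_upwards [hd.continuousAt.eventually_mem (hU.mem_nhds (hstart ▸ hpU))] with t ht
    have hcircle : (l * Real.cos t) ^ 2 + (l * Real.sin t) ^ 2 - l ^ 2 = 0 := by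
      linear_combination l ^ 2 * Real.sin_sq_add_cos_sq t
    refine ⟨ht, hcircle, ?_⟩
    change (c * Real.cos t - l * Real.cos t) ^ 2 + (l * Real.sin t) ^ 2 - l ^ 2 = 0
    rw [hc t, hcircle]
  have h₁ := tangent (2 * l) fun t => by ring
  have h₂ := tangent 0 fun t => by ring
  set v : Fin 3 → ℝ := ![-l, 0, -(2 * l)] with hv
  set w : Fin 3 → ℝ := ![-l, 0, -0] with hw
  have hdep : A w 0 • v = A v 0 • w := by
    apply hA
    rw [map_smul, map_smul]
    ext i
    fin_cases i
    · simp [mul_comm]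
    · simp [h₁ 1, h₂ 1]
    · simp [h₁ 2, h₂ 2]
  have hAw : A w 0 = 0 := by
    have := congrFun hdep 2
    simpa [hv, hw, hl.ne'] using this
  have hw0 : w = 0 := by
    apply hA
    rw [map_zero]
    ext i
    fin_cases i
    · exact hAw
    · exact h₂ 1 le_rfl
    · exact h₂ 2 one_le_two
  have := congrFun hw0 0
  simp [hw, hl.ne'] at this
end

section
/- Let l₁, l₂ > 0 with l₁ ≠ l₂, and define f₁, f₂ : ℝ³ → ℝ by f₁(x_B, y_B, x_C) = x_B² + y_B² − l₁² and f₂(x_B, y_B, x_C) = (x_C − x_B)² + y_B² − l₂². Then at every point p ∈ ℝ³ with f₁(p) = f₂(p) = 0, the total derivative of the map (f₁, f₂) : ℝ³ → ℝ² at p is surjective (the 2×3 Jacobian has rank 2). Consequently the configuration space of the crank-slider with unequal link lengths has no configuration space singularities. -/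
/-- The derivative of the crank-slider constraint map, applied to a tangent vector. -/
lemma fderiv_crank_slider_apply (l₁ l₂ : ℝ) (p v : Fin 3 → ℝ) :
    fderiv ℝ (fun x : Fin 3 → ℝ =>
        (![x 0 ^ 2 + x 1 ^ 2 - l₁ ^ 2, (x 2 - x 0) ^ 2 + x 1 ^ 2 - l₂ ^ 2] : Fin 2 → ℝ)) p v =
      ![2 * p 0 * v 0 + 2 * p 1 * v 1, 2 * (p 2 - p 0) * (v 2 - v 0) + 2 * p 1 * v 1] := by
  have coord (i : Fin 3) : HasFDerivAt (fun x : Fin 3 → ℝ => x i)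
      (ContinuousLinearMap.proj (R := ℝ) (φ := fun _ : Fin 3 => ℝ) i) p := hasFDerivAt_apply i p
  have hf₁ := (((coord 0).pow 2).add ((coord 1).pow 2)).sub_const (l₁ ^ 2)
  have hf₂ := ((((coord 2).sub (coord 0)).pow 2).add ((coord 1).pow 2)).sub_const (l₂ ^ 2)
  have hf := hasFDerivAt_pi.2 (Fin.forall_fin_two.2 ⟨hf₁, hf₂⟩ :
    ∀ i : Fin 2, HasFDerivAt (fun x : Fin 3 → ℝ =>
      (![x 0 ^ 2 + x 1 ^ 2 - l₁ ^ 2, (x 2 - x 0) ^ 2 + x 1 ^ 2 - l₂ ^ 2] : Fin 2 → ℝ) i)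
      ((![_, _] : Fin 2 → (Fin 3 → ℝ) →L[ℝ] ℝ) i) p)
  rw [hf.fderiv]
  ext i
  fin_cases i <;> simp

/-- For the crank-slider with unequal link lengths, the constraint map is a submersion at
every point of the configuration space; hence there are no configuration space
singularities. -/
theorem crank_slider_unequal_lengths_regular (l₁ l₂ : ℝ) (h₁ : l₁ > 0) (h₂ : l₂ > 0)
    (hne : l₁ ≠ l₂) (p : Fin 3 → ℝ)
    (hp : p 0 ^ 2 + p 1 ^ 2 - l₁ ^ 2 = 0 ∧ (p 2 - p 0) ^ 2 + p 1 ^ 2 - l₂ ^ 2 = 0) :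
    Function.Surjective
      (fderiv ℝ (fun x : Fin 3 → ℝ =>
        (![x 0 ^ 2 + x 1 ^ 2 - l₁ ^ 2, (x 2 - x 0) ^ 2 + x 1 ^ 2 - l₂ ^ 2] : Fin 2 → ℝ)) p) := by
  intro y
  obtain ⟨hp₁, hp₂⟩ := hp
  suffices h : ∃ a b c : ℝ, 2 * p 0 * a + 2 * p 1 * b = y 0 ∧
      2 * (p 2 - p 0) * (c - a) + 2 * p 1 * b = y 1 by
    obtain ⟨a, b, c, hy₀, hy₁⟩ := h
    refine ⟨![a, b, c], ?_⟩
    rw [fderiv_crank_slider_apply]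
    ext i
    fin_cases i
    · simpa using hy₀
    · simpa using hy₁
  by_cases hd : p 2 - p 0 = 0
  · have hb : p 1 ≠ 0 := by
      intro hb
      rw [hd, hb] at hp₂
      nlinarith
    have ha : p 0 ≠ 0 := by
      intro ha
      rw [ha] at hp₁
      rw [hd] at hp₂
      exact hne ((sq_eq_sq₀ h₁.le h₂.le).1 (by linarith))
    refine ⟨(y 0 - y 1) / (2 * p 0), y 1 / (2 * p 1), 0, ?_, ?_⟩
    · field_simp
      ring
    · rw [hd]
      field_simp
      ring
  · have hl : p 0 ^ 2 + p 1 ^ 2 = l₁ ^ 2 := by linarith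
    set b := p 1 * y 0 / (2 * l₁ ^ 2)
    refine ⟨p 0 * y 0 / (2 * l₁ ^ 2), b,
      p 0 * y 0 / (2 * l₁ ^ 2) + (y 1 - 2 * p 1 * b) / (2 * (p 2 - p 0)), ?_, ?_⟩
    · simp only [b]
      field_simp
      linear_combination y 0 * hl
    · rw [add_sub_cancel_left, mul_div_cancel₀ _ (mul_ne_zero two_ne_zero hd)]
      ring
end
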